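/- arXiv:1011.6338 — 6 statements merged into one kernel-verified Lean document; each statement's English description precedes it below -/
import Mathlib

section
/- Let $u_c = \frac{3^{1/4}}{18}$. There exists a function $x_1$ that is analytic on the open disk $\{u \in \mathbb{C} : |u| < u_c\}$ such that $x_1(0) = 0$, $x_1'(0) = 6$, and $18u^2 x_1(u)^3 - 9u\, x_1(u)^2 + x_1(u) - 6u = 0$ for all $u$ with $|u| < u_c$. -/
open Complex in
theorem aux_w : ∃ w : ℂ → ℂ, DifferentiableOn ℂ w (Metric.ball (0:ℂ) 1) ∧ w 0 = 0 ∧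
    ∀ z ∈ Metric.ball (0:ℂ) 1, w z * (1 - 3 * w z) * (1 - 6 * w z) = ((Real.sqrt 3 : ℝ) : ℂ) / 54 * z := by
  obtain ⟨k, hk⟩ : ∃ k : ℂ, k = ((Real.sqrt 3 : ℝ) : ℂ) := ⟨_, rfl⟩
  have hk2 : k ^ 2 = 3 := by
    rw [hk, ← Complex.ofReal_pow, Real.sq_sqrt (by norm_num)]; norm_num
  rw [← hk]
  let S : ℂ → ℂ := fun z => exp (log (1 - z ^ 2) / 2)
  let R : ℂ → ℂ := fun z => S z + I * z
  let L : ℂ → ℂ := fun z => log (R z) / 3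
  have h1 : ∀ z ∈ Metric.ball (0:ℂ) 1, 1 - z ^ 2 ∈ slitPlane := by
    intro z hz
    rw [mem_ball_zero_iff] at hz
    left
    have : ‖z ^ 2‖ < 1 := by rw [norm_pow]; nlinarith [norm_nonneg z]
    have h2 := re_le_norm (z ^ 2)
    rw [sub_re, one_re]; linarith
  have hS2 : ∀ z ∈ Metric.ball (0:ℂ) 1, S z ^ 2 = 1 - z ^ 2 := by
    intro z hz
    change exp (log (1 - z ^ 2) / 2) ^ 2 = _
    rw [← exp_nat_mul]
    push_cast
    rw [mul_div_cancel₀ _ (by norm_num), exp_log (slitPlane_ne_zero (h1 z hz))]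
  have hSre : ∀ z ∈ Metric.ball (0:ℂ) 1, 0 < (S z).re := by
    intro z hz
    change 0 < (exp (log (1 - z ^ 2) / 2)).re
    rw [exp_re]
    apply mul_pos (Real.exp_pos _)
    have e : (log (1 - z ^ 2) / 2).im = arg (1 - z^2) / 2 := by
      rw [← log_im]; simp
    rw [e]
    have h3 := arg_lt_pi_iff.2 ((mem_slitPlane_iff.1 (h1 z hz)).imp le_of_lt id)
    have h4 := neg_pi_lt_arg (1 - z^2)
    apply Real.cos_pos_of_mem_Ioo
    constructor <;> linarith
  have hRR : ∀ z ∈ Metric.ball (0:ℂ) 1, R z * (S z - I * z) = 1 := by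
    intro z hz
    change (S z + I * z) * (S z - I * z) = 1
    linear_combination hS2 z hz - z ^ 2 * I_sq
  have hR : ∀ z ∈ Metric.ball (0:ℂ) 1, R z ∈ slitPlane := by
    intro z hz
    by_contra hc
    rw [mem_slitPlane_iff] at hc
    push Not at hc
    obtain ⟨ha, hb⟩ := hc
    have h5 := congrArg re (hRR z hz)
    rw [mul_re, hb, one_re] at h5
    have h6 : (R z).re + (S z - I * z).re = 2 * (S z).re := by
      change (S z + I * z).re + _ = _
      rw [add_re, sub_re]; ring
    have := hSre z hz
    nlinarith
  have hS0 : S 0 = 1 := by simp [S]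
  have hL0 : L 0 = 0 := by simp [L, R, hS0]
  refine ⟨fun z => 1/6 + k/9 * (((-k - I)/2 * exp (L z) + (-k + I)/2 * exp (-L z)) / 2), ?_, ?_, ?_⟩
  · have hSd : DifferentiableOn ℂ S (Metric.ball (0:ℂ) 1) := by
      apply DifferentiableOn.cexp
      apply DifferentiableOn.div_const
      exact DifferentiableOn.clog (by fun_prop) h1
    have hRd : DifferentiableOn ℂ R (Metric.ball (0:ℂ) 1) := hSd.add (by fun_prop)
    have hLd : DifferentiableOn ℂ L (Metric.ball (0:ℂ) 1) := (hRd.clog hR).div_const _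
    have e1 := hLd.cexp
    have e2 := hLd.neg.cexp
    exact (((((e1.const_mul ((-k - I)/2)).add (e2.const_mul ((-k + I)/2))).div_const 2).const_mul (k/9)).const_add (1/6))
  · simp only [hL0, neg_zero, exp_zero]
    linear_combination (-1/18) * hk2
  · intro z hz
    have q3 : exp (L z) ^ 3 = S z + I * z := by
      change exp (log (R z) / 3) ^ 3 = R z
      rw [← exp_nat_mul]
      push_cast
      rw [mul_div_cancel₀ _ (by norm_num), exp_log (slitPlane_ne_zero (hR z hz))]
    have qp : exp (L z) * exp (-L z) = 1 := by rw [← exp_add]; simp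
    have p3 : exp (-L z) ^ 3 = S z - I * z := by
      have h7 : (S z + I * z) * exp (-L z) ^ 3 = 1 := by rw [← q3, ← mul_pow, qp, one_pow]
      have h8 := hRR z hz
      change (S z + I * z) * (S z - I * z) = 1 at h8
      exact mul_left_cancel₀ (left_ne_zero_of_mul_eq_one h8) (h7.trans h8.symm)
    simp only
    generalize exp (L z) = q at *
    generalize exp (-L z) = p at *
    generalize S z = s at *
    have c1 : ((-k - I)/2) * ((-k + I)/2) = 1 := by
      linear_combination hk2 / 4 - I_sq / 4
    have c2 : ((-k - I)/2) ^ 3 = -I := by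
      linear_combination (-k/8 - 3*I/8) * hk2 + (-3*k/8 - I/8) * I_sq
    have c3 : ((-k + I)/2) ^ 3 = I := by
      linear_combination (-k/8 + 3*I/8) * hk2 + (-3*k/8 + I/8) * I_sq
    generalize (-k - I)/2 = c at *
    generalize (-k + I)/2 = d at *
    obtain ⟨A, hA⟩ : ∃ A, A = c * q := ⟨_, rfl⟩
    obtain ⟨B, hB⟩ : ∃ B, B = d * p := ⟨_, rfl⟩
    have hAB : A * B = 1 := by rw [hA, hB]; linear_combination q * p * c1 + qp
    have hA3 : A ^ 3 = -I * (s + I * z) := by rw [hA, mul_pow, c2, q3]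
    have hB3 : B ^ 3 = I * (s - I * z) := by rw [hB, mul_pow, c3, p3]
    rw [← hA, ← hB]
    obtain ⟨y, hy⟩ : ∃ y, y = (A + B) / 2 := ⟨_, rfl⟩
    have hy3 : 4 * y ^ 3 - 3 * y = z := by
      rw [hy]
      linear_combination hA3 / 2 + hB3 / 2 + 3 / 2 * (A + B) * hAB - z * I_sq
    rw [← hy]
    linear_combination k / 54 * hy3 + 18 * k * y ^ 3 / 729 * hk2

theorem stmt3 :
    ∃ x1 : ℂ → ℂ,
      AnalyticOnNhd ℂ x1 (Metric.ball (0 : ℂ) ((3 : ℝ) ^ ((1 : ℝ) / 4) / 18)) ∧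
      x1 0 = 0 ∧ deriv x1 0 = 6 ∧
      ∀ u ∈ Metric.ball (0 : ℂ) ((3 : ℝ) ^ ((1 : ℝ) / 4) / 18),
        18 * u ^ 2 * x1 u ^ 3 - 9 * u * x1 u ^ 2 + x1 u - 6 * u = 0 := by
  obtain ⟨w, hwd, hw0, hw⟩ := aux_w
  have hr : ((3 : ℝ) ^ ((1 : ℝ) / 4)) ^ 2 = Real.sqrt 3 := by
    rw [← Real.rpow_natCast, ← Real.rpow_mul (by norm_num), Real.sqrt_eq_rpow]
    norm_num
  have hrpos : 0 < (3 : ℝ) ^ ((1 : ℝ) / 4) := by positivity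
  generalize (3 : ℝ) ^ ((1 : ℝ) / 4) = ρ at *
  have hs2 : Real.sqrt 3 ^ 2 = 3 := Real.sq_sqrt (by norm_num)
  have hspos : 0 < Real.sqrt 3 := by positivity
  have hk2 : ((Real.sqrt 3 : ℝ) : ℂ) ^ 2 = 3 := by
    rw [← Complex.ofReal_pow, hs2]; norm_num
  let g : ℂ → ℂ := fun u => 108 * ((Real.sqrt 3 : ℝ) : ℂ) * u ^ 2
  have hg : ∀ u ∈ Metric.ball (0 : ℂ) (ρ / 18), g u ∈ Metric.ball (0:ℂ) 1 := by
    intro u hu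
    rw [mem_ball_zero_iff] at hu ⊢
    have : ‖g u‖ = 108 * Real.sqrt 3 * ‖u‖ ^ 2 := by
      simp [g, abs_of_pos hspos]
    rw [this]
    have h2 : ‖u‖ ^ 2 < (ρ / 18) ^ 2 := by gcongr
    have h3 : (ρ / 18) ^ 2 = Real.sqrt 3 / 324 := by rw [div_pow, hr]; norm_num
    rw [h3] at h2
    nlinarith
  let W : ℂ → ℂ := fun u => w (g u)
  have hW0 : W 0 = 0 := by simp [W, g, hw0]
  have hW : ∀ u ∈ Metric.ball (0 : ℂ) (ρ / 18), W u * (1 - 3 * W u) * (1 - 6 * W u) = 6 * u ^ 2 := by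
    intro u hu
    refine (hw (g u) (hg u hu)).trans ?_
    change _ * (108 * _ * u ^ 2) = _
    linear_combination 2 * u ^ 2 * hk2
  have hWd : DifferentiableOn ℂ W (Metric.ball (0 : ℂ) (ρ / 18)) :=
    hwd.comp (by fun_prop) hg
  let D : ℂ → ℂ := fun u => (1 - 3 * W u) * (1 - 6 * W u)
  have hD0 : D 0 = 1 := by simp [D, hW0]
  have hD : ∀ u ∈ Metric.ball (0 : ℂ) (ρ / 18), D u ≠ 0 := by
    intro u hu h
    have h1 := hW u hu
    rw [mul_assoc] at h1
    change W u * D u = _ at h1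
    rw [h, mul_zero] at h1
    have : u = 0 := by simpa using h1.symm
    rw [this, hD0] at h
    exact one_ne_zero h
  have hDd : DifferentiableOn ℂ D (Metric.ball (0 : ℂ) (ρ / 18)) :=
    ((hWd.const_mul 3).const_sub 1).mul ((hWd.const_mul 6).const_sub 1)
  have h0 : (0:ℂ) ∈ Metric.ball (0 : ℂ) (ρ / 18) := Metric.mem_ball_self (by positivity)
  refine ⟨fun u => 6 * u / D u, ?_, by simp, ?_, ?_⟩
  · apply DifferentiableOn.analyticOnNhd _ Metric.isOpen_ball
    exact DifferentiableOn.div (by fun_prop) hDd hD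
  · have hDa : HasDerivAt D (deriv D 0) 0 :=
      (hDd.differentiableAt (Metric.isOpen_ball.mem_nhds h0)).hasDerivAt
    have h6 : HasDerivAt (fun u : ℂ => 6 * u) 6 0 := by
      simpa using (hasDerivAt_id (0:ℂ)).const_mul 6
    have := (h6.fun_div hDa (hD 0 h0)).deriv
    rw [this, hD0]; simp
  · intro u hu
    have hx : 6 * u / D u * D u = 6 * u := div_mul_cancel₀ _ (hD u hu)
    have hxw : u * (6 * u / D u) = W u := by
      apply mul_right_cancel₀ (hD u hu)
      have h1 := hW u hu
      rw [mul_assoc] at h1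
      change W u * D u = _ at h1
      rw [h1]
      linear_combination u * hx
    simp only
    have hDu : D u = (1 - 3 * W u) * (1 - 6 * W u) := rfl
    generalize 6 * u / D u = x at *
    rw [hDu, ← hxw] at hx
    linear_combination hx
end

section
/- Let $u_c = \frac{3^{1/4}}{18}$ and let $u$ be a real number with $0 < u < u_c$. Suppose $x, y$ are real numbers satisfying $2x^2 + y^2 = \frac{2x}{3u}$ and $\frac{y^2}{4}(1 - 6ux) = 1$. Then $\left(\frac{1}{3u} - 2x\right)^2 \neq y^2$; equivalently, the point $z_0 = \frac{1}{3u} - x$ is different from both endpoints $a = x - y$ and $b = x + y$. -/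
/-- For `0 < u < u_c = 3^{1/4}/18` and real `x, y` with `2x² + y² = 2x/(3u)` and
`(y²/4)(1 - 6ux) = 1`, the point `z₀ = 1/(3u) - x` differs from both endpoints
`a = x - y` and `b = x + y`; equivalently `(1/(3u) - 2x)² ≠ y²`. -/
theorem stmt6 (u x y : ℝ) (hu0 : 0 < u) (huc : u < (3 : ℝ) ^ ((1 : ℝ) / 4) / 18)
    (h1 : 2 * x ^ 2 + y ^ 2 = 2 * x / (3 * u))
    (h2 : y ^ 2 / 4 * (1 - 6 * u * x) = 1) :
    (1 / (3 * u) - 2 * x) ^ 2 ≠ y ^ 2 ∧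
      1 / (3 * u) - x ≠ x - y ∧ 1 / (3 * u) - x ≠ x + y := by
  have hc : ((3 : ℝ) ^ ((1 : ℝ) / 4)) ^ 4 = 3 := by
    rw [← Real.rpow_natCast, ← Real.rpow_mul (by norm_num)]
    norm_num
  have hu4 : (18 * u) ^ 4 < 3 := by
    rw [← hc]
    exact pow_lt_pow_left₀ (by linarith) (by positivity) (by norm_num)
  have key : (1 / (3 * u) - 2 * x) ^ 2 ≠ y ^ 2 := by
    intro h
    obtain ⟨w, hw⟩ : ∃ w : ℝ, w = 1 / (3 * u) := ⟨_, rfl⟩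
    have huw : 3 * u * w = 1 := by rw [hw]; field_simp
    have h1' : 2 * x ^ 2 + y ^ 2 = 2 * x * w := by rw [h1, hw]; ring
    rw [← hw] at h
    have e1 : w ^ 2 - 6 * w * x + 6 * x ^ 2 = 0 := by linarith
    have e2 : y ^ 2 = w ^ 2 / 3 := by linarith
    have e3 : w ^ 2 * (1 - 6 * u * x) = 12 := by rw [e2] at h2; linarith
    have e4 : w * (w - 2 * x) = 12 := by
      linear_combination e3 + 2 * x * w * huw
    have e5 : (w - 2 * x) ^ 2 = w ^ 2 / 3 := by linarith
    have e6 : w ^ 4 = 432 := by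
      have : (w * (w - 2 * x)) ^ 2 = 144 := by rw [e4]; norm_num
      rw [mul_pow, e5] at this
      linarith
    have e7 : (3 * u * w) ^ 4 = 1 := by rw [huw]; norm_num
    rw [mul_pow, e6] at e7
    nlinarith
  refine ⟨key, fun h => key ?_, fun h => key ?_⟩
  · have : 1 / (3 * u) - 2 * x = -y := by linarith
    rw [this]; ring
  · have : 1 / (3 * u) - 2 * x = y := by linarith
    rw [this]
end

section
/- Let $U \subseteq \mathbb{C}$ be an open set and let $g : U \to \mathbb{C}$ be analytic with $g(w) \neq 0$, $108\,g(w) \neq 1$, and $72\,g(w)^3 - g(w)^2 + w^2 = 0$ for all $w \in U$. Define $b(w) = \frac{g(w) - w}{6 g(w)}$. Suppose $g_2, b_2 : U \to \mathbb{C}$ satisfy, for all $w \in U$, the linear system $6 g_2(w) + (6 b(w) - 1) b_2(w) = -\frac{3}{4} g''(w)$ and $(1 - 6 b(w)) g_2(w) - 6 g(w) b_2(w) = \frac{3}{4} g(w) b''(w)$. Then for all $w \in U$: $g_2(w) = \frac{162\, g(w)\,(5 - 324\, g(w))}{(1 - 108\, g(w))^4}$ and $b_2(w) = \frac{54\, w}{g(w)\,(1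 - 108\, g(w))^4}$. -/
/-- The order-`N⁻²` string equations determine the genus-one coefficients `g₂, b₂` explicitly
in terms of the leading coefficient `g` (solving `72g³ - g² + w² = 0`) and
`b = (g - w)/(6g)`. -/
theorem stmt10 (U : Set ℂ) (hU : IsOpen U) (g : ℂ → ℂ) (hg : AnalyticOnNhd ℂ g U)
    (hg0 : ∀ w ∈ U, g w ≠ 0) (hg1 : ∀ w ∈ U, 108 * g w ≠ 1)
    (hcubic : ∀ w ∈ U, 72 * g w ^ 3 - g w ^ 2 + w ^ 2 = 0)
    (b : ℂ → ℂ) (hb : ∀ w, b w = (g w - w) / (6 * g w))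
    (g2 b2 : ℂ → ℂ)
    (hsys1 : ∀ w ∈ U,
      6 * g2 w + (6 * b w - 1) * b2 w = -(3 / 4) * iteratedDeriv 2 g w)
    (hsys2 : ∀ w ∈ U,
      (1 - 6 * b w) * g2 w - 6 * g w * b2 w = 3 / 4 * g w * iteratedDeriv 2 b w) :
    ∀ w ∈ U,
      g2 w = 162 * g w * (5 - 324 * g w) / (1 - 108 * g w) ^ 4 ∧
      b2 w = 54 * w / (g w * (1 - 108 * g w) ^ 4) := by
  have hD : ∀ w ∈ U, 1 - 108 * g w ≠ 0 := fun w hw h => hg1 w hw (by linear_combination -h)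
  have hg' : ∀ w ∈ U, HasDerivAt g (w / (g w * (1 - 108 * g w))) w := by
    intro w hw
    have h1 : HasDerivAt g (deriv g w) w := (hg w hw).differentiableAt.hasDerivAt
    have h2 := (((h1.pow 3).const_mul 72).sub (h1.pow 2)).add ((hasDerivAt_id w).pow 2)
    have h3 : HasDerivAt (fun _ : ℂ => (0 : ℂ)) _ w := h2.congr_of_eventuallyEq (by
      filter_upwards [hU.mem_nhds hw] with z hz
      have := hcubic z hz
      simp only [Pi.add_apply, Pi.sub_apply, Pi.pow_apply, id]
      exact this.symm)
    have h4 := h3.unique (hasDerivAt_const w (0 : ℂ))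
    simp at h4
    have h5 : deriv g w = w / (g w * (1 - 108 * g w)) := by
      rw [eq_div_iff (mul_ne_zero (hg0 w hw) (hD w hw))]
      linear_combination -(1 / 2) * h4
    rwa [h5] at h1
  have hb' : ∀ w ∈ U, HasDerivAt b (6 / (1 - 108 * g w)) w := by
    intro w hw
    have h0 := hg0 w hw
    have hd := hD w hw
    have h2 := ((hg' w hw).sub (hasDerivAt_id w)).div ((hg' w hw).const_mul 6)
      (mul_ne_zero (by norm_num) h0)
    have h3 := h2.congr_of_eventuallyEq (f₁ := b) (Filter.Eventually.of_forall fun z => by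
      simp [hb z])
    refine h3.congr_deriv ?_
    simp only [Pi.sub_apply, id]
    have hc := hcubic w hw
    generalize g w = x at *
    have hd' : 1 - x * 108 ≠ 0 := by rw [mul_comm x]; exact hd
    field_simp
    linear_combination hc
  intro w hw
  have h0 := hg0 w hw
  have hd := hD w hw
  have hc := hcubic w hw
  have hgw := hg' w hw
  have hg'' : iteratedDeriv 2 g w = 72 * (1 - 54 * g w) / (1 - 108 * g w) ^ 3 := by
    rw [iteratedDeriv_succ, iteratedDeriv_one]
    have e : Filter.EventuallyEq (nhds w) (deriv g) fun z => z / (g z * (1 - 108 * g z)) := by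
      filter_upwards [hU.mem_nhds hw] with z hz using (hg' z hz).deriv
    rw [e.deriv_eq]
    have h2 := (hasDerivAt_id w).div (hgw.mul ((hgw.const_mul 108).const_sub 1))
      (mul_ne_zero h0 hd)
    refine h2.deriv.trans ?_
    simp only [Pi.mul_apply, id]
    generalize g w = x at *
    have hd' : 1 - x * 108 ≠ 0 := by rw [mul_comm x]; exact hd
    field_simp
    linear_combination (216 * x - 1) * hc
  have hb'' : iteratedDeriv 2 b w = 648 * w / (g w * (1 - 108 * g w) ^ 3) := by
    rw [iteratedDeriv_succ, iteratedDeriv_one]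
    have e : Filter.EventuallyEq (nhds w) (deriv b) fun z => 6 / (1 - 108 * g z) := by
      filter_upwards [hU.mem_nhds hw] with z hz using (hb' z hz).deriv
    rw [e.deriv_eq]
    have h2 := (hasDerivAt_const w (6 : ℂ)).div ((hgw.const_mul 108).const_sub 1) hd
    refine h2.deriv.trans ?_
    generalize g w = x at *
    have hd' : 1 - x * 108 ≠ 0 := by rw [mul_comm x]; exact hd
    field_simp
    ring
  have s1 := hsys1 w hw
  have s2 := hsys2 w hw
  rw [hg'', hb w] at s1
  rw [hb'', hb w] at s2
  generalize g w = x at *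
  generalize g2 w = p at *
  generalize b2 w = q at *
  have t1 : (6 * x * p - w * q) * (1 - 108 * x) ^ 3 = -54 * x * (1 - 54 * x) := by
    have hd' : 1 - x * 108 ≠ 0 := by rw [mul_comm x]; exact hd
    field_simp at s1
    linear_combination (1 / 4) * s1
  have t2 : (w * p - 6 * x ^ 2 * q) * (1 - 108 * x) ^ 3 = 486 * w * x := by
    have hd' : 1 - x * 108 ≠ 0 := by rw [mul_comm x]; exact hd
    field_simp at s2
    linear_combination (1 / 4) * s2
  have hx2 : x ^ 2 ≠ 0 := pow_ne_zero 2 h0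
  constructor
  · rw [eq_div_iff (pow_ne_zero 4 hd)]
    apply mul_left_cancel₀ hx2
    linear_combination (-6 * x ^ 2) * t1 + w * t2 + (486 * x - p * (1 - 108 * x) ^ 3) * hc
  · rw [eq_div_iff (mul_ne_zero h0 (pow_ne_zero 4 hd))]
    apply mul_left_cancel₀ h0
    linear_combination -w * t1 + 6 * x * t2 + q * (1 - 108 * x) ^ 3 * (-1) * hc
end

section
/- Let $w_c = \frac{\sqrt{3}}{324}$ and let $v(w) = \sum_{j=1}^\infty c_j w^j$ with $c_j = \frac{72^{j-1}\,\Gamma(\tfrac{3j}{2}-1)}{2\,\Gamma(j)\,\Gamma(\tfrac{j}{2}+1)}$ be the analytic solution of $72v^3 - v^2 + w^2 = 0$ on the disk $|w| < w_c$ with $v(0) = 0$. Then the function $\hat{g}_2(w) = \frac{162\, v(w)\,(5 - 324\, v(w))}{(1 - 108\, v(w))^4}$ is analytic on $|w| < w_c$, and for every integer $j \geq 1$ its Taylor coefficient of order $j$ at $w = 0$ equals $162 \cdot 72^{j-1} \sum_{m=0}^{j-1} \frac{\Gamma(\tfrac{3j}{2}-m)}{\Gamma(j-m)\,\Gamma(\tfrac{j}{2}+1)}\,(m+1)(m+5)\left(\frac{3}{2}\right)^m$,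 where $\Gamma$ is the Euler Gamma function. -/
/-- Taylor coefficients `c_j = 72^{j-1} Γ(3j/2 - 1) / (2 Γ(j) Γ(j/2 + 1))` of the branch
`v(w)` of `72 v³ - v² + w² = 0` analytic at `w = 0`. -/
noncomputable def cCoeff (j : ℕ) : ℝ :=
  72 ^ (j - 1) * Real.Gamma (3 * j / 2 - 1) / (2 * Real.Gamma j * Real.Gamma (j / 2 + 1))

/-- The analytic solution `v(w) = ∑_{j≥1} c_j w^j` of `72v³ - v² + w² = 0` on `|w| < √3/324`. -/
noncomputable def vFun (w : ℂ) : ℂ := ∑' j : ℕ, (cCoeff (j + 1) : ℂ) * w ^ (j + 1)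

/-- The genus-one coefficient `ĝ₂(w) = 162 v(w)(5 - 324 v(w)) / (1 - 108 v(w))⁴`. -/
noncomputable def gHat2 (w : ℂ) : ℂ :=
  162 * vFun w * (5 - 324 * vFun w) / (1 - 108 * vFun w) ^ 4


section formal
open PowerSeries

noncomputable def phiAux : ℕ → ℝ
  | 0 => 1
  | k + 1 => 72 * (k + 1 / 2) * phiAux k / (k + 1)

noncomputable def phiS : PowerSeries ℝ := PowerSeries.mk phiAux

lemma phiS_const : constantCoeff phiS = 1 := by
  rw [← coeff_zero_eq_constantCoeff_apply, phiS, coeff_mk, phiAux]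

lemma coeff_one_sub_C_X_mul (a : ℝ) (P : PowerSeries ℝ) (n : ℕ) :
    coeff (n + 1) ((1 - C a * X) * P) = coeff (n + 1) P - a * coeff n P := by
  rw [sub_mul, one_mul, map_sub, mul_assoc, coeff_C_mul, coeff_succ_X_mul]

lemma coeff_zero_one_sub_C_X_mul (a : ℝ) (P : PowerSeries ℝ) :
    coeff 0 ((1 - C a * X) * P) = coeff 0 P := by
  simp


lemma phiS_ode : (1 - C (72 : ℝ) * X) * d⁄dX ℝ phiS = C (36 : ℝ) * phiS := by
  ext n
  rcases n with _ | n
  · rw [coeff_zero_one_sub_C_X_mul, coeff_C_mul, coeff_derivative]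
    simp only [phiS, coeff_mk, phiAux]
    norm_num
  · rw [coeff_one_sub_C_X_mul, coeff_C_mul, coeff_derivative, coeff_derivative]
    simp only [phiS, coeff_mk]
    have : phiAux (n + 1 + 1) = 72 * (((n + 1 : ℕ) : ℝ) + 1 / 2) * phiAux (n + 1) / (((n + 1 : ℕ) : ℝ) + 1) := rfl
    rw [this]
    push_cast
    field_simp
    ring

lemma phiS_pow_ode (n : ℕ) :
    (1 - C (72 : ℝ) * X) * d⁄dX ℝ (phiS ^ n) = C (36 * n : ℝ) * phiS ^ n := by
  induction n with
  | zero => simp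
  | succ n ih =>
    rw [pow_succ, Derivation.leibniz, smul_eq_mul, smul_eq_mul]
    have h := phiS_ode
    have hC : C (36 * ((n + 1 : ℕ) : ℝ)) = C (36 * n : ℝ) + C (36 : ℝ) := by
      rw [← map_add]; congr 1; push_cast; ring
    rw [hC]
    linear_combination phiS * ih + phiS ^ n * h

lemma phiS_pow_coeff_succ (n k : ℕ) :
    coeff (k + 1) (phiS ^ n) * (k + 1) = 72 * (k + n / 2) * coeff k (phiS ^ n) := by
  have h := congrArg (coeff k) (phiS_pow_ode n)
  rcases k with _ | k
  · rw [coeff_zero_one_sub_C_X_mul, coeff_C_mul, coeff_derivative] at h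
    push_cast at h ⊢
    linarith
  · rw [coeff_one_sub_C_X_mul, coeff_C_mul, coeff_derivative, coeff_derivative] at h
    push_cast at h ⊢
    linarith

lemma phiS_sq : phiS ^ 2 * (1 - C (72 : ℝ) * X) = 1 := by
  ext n
  rw [mul_comm]
  rcases n with _ | n
  · simp [phiS_const]
  · rw [coeff_one_sub_C_X_mul]
    have h := phiS_pow_coeff_succ 2 n
    have h2 : ((n : ℝ) + 1) ≠ 0 := by positivity
    have : coeff (n + 1) (phiS ^ 2) = 72 * coeff n (phiS ^ 2) := by
      apply mul_right_cancel₀ h2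
      rw [h]; push_cast; ring
    rw [this]
    simp [coeff_one]

lemma phiS_pow_coeff (n k : ℕ) :
    coeff k (phiS ^ (n + 2)) =
      72 ^ k * (Real.Gamma (n / 2 + 1 + k) / (Real.Gamma (k + 1) * Real.Gamma (n / 2 + 1))) := by
  induction k with
  | zero =>
    have : Real.Gamma ((n : ℝ) / 2 + 1) ≠ 0 := (Real.Gamma_pos_of_pos (by positivity)).ne'
    simp [phiS_const, this]
  | succ k ih =>
    have h := phiS_pow_coeff_succ (n + 2) k
    rw [ih] at h
    have h2 : ((k : ℝ) + 1) ≠ 0 := by positivity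
    apply mul_right_cancel₀ h2
    rw [h]
    have e1 : Real.Gamma ((n : ℝ) / 2 + 1 + ((k + 1 : ℕ) : ℝ)) =
        ((n : ℝ) / 2 + 1 + k) * Real.Gamma ((n : ℝ) / 2 + 1 + k) := by
      rw [← Real.Gamma_add_one (by positivity)]; congr 1; push_cast; ring
    have e2 : Real.Gamma (((k + 1 : ℕ) : ℝ) + 1) = (k + 1) * Real.Gamma ((k : ℝ) + 1) := by
      rw [← Real.Gamma_add_one (by positivity)]; congr 1; push_cast; ring
    rw [e1, e2]
    have g1 : Real.Gamma ((n : ℝ) / 2 + 1) ≠ 0 := (Real.Gamma_pos_of_pos (by positivity)).ne'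
    have g2 : Real.Gamma ((k : ℝ) + 1) ≠ 0 := (Real.Gamma_pos_of_pos (by positivity)).ne'
    push_cast
    field_simp
    ring

noncomputable def fS : PowerSeries ℝ := X * phiS * (1 - C (72 : ℝ) * X)

lemma fS_mul_phi : fS * phiS = X := by
  have := phiS_sq
  unfold fS
  linear_combination X * this

lemma fS_sq : fS ^ 2 = X ^ 2 * (1 - C (72 : ℝ) * X) := by
  have := phiS_sq
  unfold fS
  linear_combination X ^ 2 * (1 - C (72 : ℝ) * X) * this

lemma fS_hasSubst : HasSubst fS := by
  apply HasSubst.of_constantCoeff_zero'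
  simp [fS]

noncomputable def S : PowerSeries ℝ →ₐ[ℝ] PowerSeries ℝ := substAlgHom fS_hasSubst

lemma S_X : S X = fS := substAlgHom_X _

lemma S_C (a : ℝ) : S (C a) = C a := S.commutes a

noncomputable def L (H : PowerSeries ℝ) : PowerSeries ℝ :=
  PowerSeries.mk fun n => coeff n (H * ((1 - C (108 : ℝ) * X) * phiS ^ (n + 2)))

lemma L_inj0 (H : PowerSeries ℝ) (h : L H = 0) : H = 0 := by
  ext n
  induction n using Nat.strong_induction_on with
  | _ n ih =>
    have h1 := congrArg (coeff n) h
    rw [L, coeff_mk, coeff_mul, Finset.sum_eq_single (n, 0)] at h1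
    · simpa [phiS_const] using h1
    · rintro ⟨a, b⟩ hab hne
      have hab' : a + b = n := by simpa using hab
      have : a < n := by
        rcases Nat.eq_zero_or_pos b with hb | hb
        · exfalso; apply hne; ext <;> simp <;> omega
        · omega
      simp [ih a this]
    · simp

lemma L_sub (H K : PowerSeries ℝ) : L (H - K) = L H - L K := by
  ext n; simp [L, sub_mul]

lemma L_inj {H K : PowerSeries ℝ} (h : L H = L K) : H = K := by
  rw [← sub_eq_zero]; apply L_inj0; rw [L_sub, h, sub_self]

lemma key_coeff (k : ℕ) :
    coeff k ((1 - C (108 : ℝ) * X) * phiS ^ (k + 2)) = if k = 0 then 1 else 0 := by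
  rcases k with _ | k
  · simp [phiS_const]
  · rw [coeff_one_sub_C_X_mul]
    have h := phiS_pow_coeff_succ (k + 1 + 2) k
    have h2 : ((k : ℝ) + 1) ≠ 0 := by positivity
    rw [if_neg (by omega)]
    apply mul_right_cancel₀ h2
    rw [sub_mul, h]
    push_cast
    ring

lemma LS (G : PowerSeries ℝ) : L (S G) = G := by
  ext n
  obtain ⟨R, hR⟩ : ∃ R, G = (trunc (n + 1) G : PowerSeries ℝ) + X ^ (n + 1) * R := by
    have : X ^ (n + 1) ∣ G - (trunc (n + 1) G : PowerSeries ℝ) := by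
      rw [X_pow_dvd_iff]
      intro m hm
      simp [Polynomial.coeff_coe, coeff_trunc, hm]
    obtain ⟨R, hR⟩ := this
    exact ⟨R, by rw [← hR]; ring⟩
  have hT : (trunc (n + 1) G : PowerSeries ℝ) =
      ∑ j ∈ Finset.range (n + 1), C (coeff j G) * X ^ j := by
    ext m
    simp [Polynomial.coeff_coe, coeff_trunc, coeff_X_pow]
  have hS : S G = ∑ j ∈ Finset.range (n + 1), C (coeff j G) * fS ^ j + fS ^ (n + 1) * S R := by
    conv_lhs => rw [hR, hT]
    simp [S_X, S_C]
  rw [L, coeff_mk, hS, add_mul, map_add, Finset.sum_mul, map_sum]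
  have h2 : coeff n (fS ^ (n + 1) * S R * ((1 - C (108 : ℝ) * X) * phiS ^ (n + 2))) = 0 := by
    have : fS ^ (n + 1) * S R * ((1 - C (108 : ℝ) * X) * phiS ^ (n + 2)) =
        X ^ (n + 1) * (S R * (1 - C (108 : ℝ) * X) * phiS) := by
      rw [← fS_mul_phi]; ring
    rw [this, coeff_X_pow_mul']
    simp
  rw [h2, add_zero, Finset.sum_eq_single n]
  · have : C (coeff n G) * fS ^ n * ((1 - C (108 : ℝ) * X) * phiS ^ (n + 2)) =
        C (coeff n G) * ((fS * phiS) ^ n * ((1 - C (108 : ℝ) * X) * phiS ^ (0 + 2))) := by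
      ring
    rw [this, fS_mul_phi, coeff_C_mul, coeff_X_pow_mul']
    simp [phiS_const]
  · intro j hj hne
    have hj' : j < n := by simp at hj; omega
    obtain ⟨k, rfl⟩ : ∃ k, n = j + k := ⟨n - j, by omega⟩
    have : C (coeff j G) * fS ^ j * ((1 - C (108 : ℝ) * X) * phiS ^ (j + k + 2)) =
        C (coeff j G) * ((fS * phiS) ^ j * ((1 - C (108 : ℝ) * X) * phiS ^ (k + 2))) := by
      ring
    rw [this, fS_mul_phi, coeff_C_mul, coeff_X_pow_mul', if_pos (by omega), Nat.add_sub_cancel_left,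
      key_coeff, if_neg (by omega), mul_zero]
  · simp

lemma SL (H : PowerSeries ℝ) : S (L H) = H := L_inj (LS _)

noncomputable def V : PowerSeries ℝ := L X

lemma S_V : S V = X := SL X

lemma V_coeff (n : ℕ) : coeff n V = cCoeff n := by
  rw [V, L, coeff_mk]
  rcases n with _ | _ | n
  · simp [cCoeff]
  · rw [coeff_succ_X_mul]
    have h : Real.Gamma (1 / 2 + 1) = 1 / 2 * Real.Gamma (1 / 2) := Real.Gamma_add_one (by norm_num)
    have : Real.Gamma (1 / 2) ≠ 0 := (Real.Gamma_pos_of_pos (by positivity)).ne'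
    simp only [cCoeff]
    norm_num [phiS_const] at *
    norm_num [h]
    field_simp
  · rw [coeff_succ_X_mul, coeff_one_sub_C_X_mul, phiS_pow_coeff, phiS_pow_coeff, cCoeff]
    have e1 : Real.Gamma (((n + 1 + 1 : ℕ) : ℝ) / 2 + 1 + ((n + 1 : ℕ) : ℝ)) =
        (3 * n / 2 + 2) * Real.Gamma (3 * n / 2 + 2) := by
      rw [← Real.Gamma_add_one (by positivity)]; congr 1; push_cast; ring
    have e2 : Real.Gamma (((n + 1 + 1 : ℕ) : ℝ) / 2 + 1 + (n : ℝ)) =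
        Real.Gamma (3 * n / 2 + 2) := by
      congr 1; push_cast; ring
    have e3 : Real.Gamma (3 * ((n + 1 + 1 : ℕ) : ℝ) / 2 - 1) =
        Real.Gamma (3 * n / 2 + 2) := by
      congr 1; push_cast; ring
    have e4 : Real.Gamma (((n + 1 : ℕ) : ℝ) + 1) = (n + 1) * Real.Gamma (n + 1) := by
      rw [← Real.Gamma_add_one (by positivity)]; congr 1; push_cast; ring
    have e5 : Real.Gamma ((n + 1 + 1 : ℕ) : ℝ) = (n + 1) * Real.Gamma (n + 1) := by
      rw [← Real.Gamma_add_one (by positivity)]; congr 1; push_cast; ring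
    rw [e1, e2, e3, e4, e5]
    have g1 : Real.Gamma (((n + 1 + 1 : ℕ) : ℝ) / 2 + 1) ≠ 0 :=
      (Real.Gamma_pos_of_pos (by positivity)).ne'
    have g2 : Real.Gamma ((n : ℝ) + 1) ≠ 0 := (Real.Gamma_pos_of_pos (by positivity)).ne'
    generalize Real.Gamma (((n + 1 + 1 : ℕ) : ℝ) / 2 + 1) = A at *
    have : n + 1 + 1 - 1 = n + 1 := by omega
    rw [this]
    field_simp
    ring

lemma V_cubic : C (72 : ℝ) * V ^ 3 - V ^ 2 + X ^ 2 = 0 := by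
  rw [← LS (C (72 : ℝ) * V ^ 3 - V ^ 2 + X ^ 2)]
  have : S (C (72 : ℝ) * V ^ 3 - V ^ 2 + X ^ 2) = 0 := by
    simp only [map_add, map_sub, map_mul, map_pow, S_V, S_X, S_C, fS_sq]
    ring
  rw [this]; ext; simp [L]

noncomputable def Q : PowerSeries ℝ := PowerSeries.mk fun m => (m + 1) * (m + 5) * 108 ^ m

lemma Q_eq : (1 - C (108 : ℝ) * X) ^ 3 * Q = C 5 - C 324 * X := by
  ext n
  rw [pow_succ, pow_succ, pow_one, mul_assoc, mul_assoc]
  rcases n with _ | _ | _ | n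
  · simp [Q]
  all_goals
    simp only [coeff_one_sub_C_X_mul, zero_add]
    simp [Q, coeff_C, coeff_X]
    try ring_nf
    try norm_num

lemma G_coeff (G : PowerSeries ℝ)
    (hG : G * (1 - C 108 * V) ^ 4 = C 162 * V * (C 5 - C 324 * V)) (j : ℕ) (hj : 1 ≤ j) :
    coeff j G = 162 * 72 ^ (j - 1) *
          ∑ m ∈ Finset.range j,
            Real.Gamma (3 * j / 2 - m) /
              (Real.Gamma (j - m) * Real.Gamma (j / 2 + 1)) *
            ((m + 1) * (m + 5)) * (3 / 2) ^ m := by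
  have h1 := congrArg S hG
  simp only [map_sub, map_mul, map_pow, S_V, S_C, map_one] at h1
  rw [← Q_eq] at h1
  have hne : (1 - C (108 : ℝ) * X) ≠ 0 := by
    intro h
    have := congrArg constantCoeff h
    simp at this
  have h2 : S G * (1 - C 108 * X) = C 162 * X * Q := by
    apply mul_right_cancel₀ (pow_ne_zero 3 hne)
    linear_combination h1
  rw [← LS G, L, coeff_mk, ← mul_assoc, h2]
  obtain ⟨n, rfl⟩ : ∃ n, j = n + 1 := ⟨j - 1, by omega⟩
  rw [mul_assoc, mul_assoc, coeff_C_mul, coeff_succ_X_mul, coeff_mul,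
    Finset.Nat.sum_antidiagonal_eq_sum_range_succ_mk, mul_assoc, Finset.mul_sum (a := 72 ^ _)]
  congr 1
  apply Finset.sum_congr rfl
  intro m hm
  have hm' : m ≤ n := by simp at hm; omega
  obtain ⟨k, rfl⟩ : ∃ k, n = m + k := ⟨n - m, by omega⟩
  simp only [Nat.add_sub_cancel_left, Nat.add_sub_cancel]
  rw [phiS_pow_coeff, Q, coeff_mk]
  have e1 : ((m + k + 1 : ℕ) : ℝ) / 2 + 1 + k = 3 * ((m + k + 1 : ℕ) : ℝ) / 2 - m := by
    push_cast; ring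
  have e2 : ((m + k + 1 : ℕ) : ℝ) - m = k + 1 := by push_cast; ring
  have e3 : (108 : ℝ) ^ m = 72 ^ m * (3 / 2) ^ m := by rw [← mul_pow]; norm_num
  rw [e1, e2, e3, pow_add]
  ring

end formal

section analytic
open PowerSeries

noncomputable def tay (F : ℂ → ℂ) : PowerSeries ℂ :=
  PowerSeries.mk fun n => iteratedDeriv n F 0 / (n.factorial : ℂ)

lemma tay_mul {F G : ℂ → ℂ} (hF : AnalyticAt ℂ F 0) (hG : AnalyticAt ℂ G 0) :
    tay (fun w => F w * G w) = tay F * tay G := by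
  ext n
  rw [coeff_mul, Finset.Nat.sum_antidiagonal_eq_sum_range_succ_mk, tay, coeff_mk,
    iteratedDeriv_fun_mul hF.contDiffAt hG.contDiffAt, Finset.sum_div]
  apply Finset.sum_congr rfl
  intro i hi
  have hi' : i ≤ n := by simp at hi; omega
  simp only [tay, coeff_mk]
  rw [Nat.cast_choose ℂ hi']
  have h1 : (n.factorial : ℂ) ≠ 0 := by exact_mod_cast n.factorial_ne_zero
  have h2 : (i.factorial : ℂ) ≠ 0 := by exact_mod_cast i.factorial_ne_zero
  have h3 : ((n - i).factorial : ℂ) ≠ 0 := by exact_mod_cast (n - i).factorial_ne_zero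
  field_simp

lemma tay_add {F G : ℂ → ℂ} (hF : AnalyticAt ℂ F 0) (hG : AnalyticAt ℂ G 0) :
    tay (fun w => F w + G w) = tay F + tay G := by
  ext n
  simp only [tay, coeff_mk, map_add]
  rw [iteratedDeriv_fun_add hF.contDiffAt hG.contDiffAt, add_div]

lemma tay_eq {F : ℂ → ℂ} {c : ℕ → ℂ}
    (h : HasFPowerSeriesAt F (FormalMultilinearSeries.ofScalars ℂ c) 0) :
    tay F = PowerSeries.mk c := by
  have h2 := h.analyticAt.hasFPowerSeriesAt
  have := h2.eq_formalMultilinearSeries h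
  have := FormalMultilinearSeries.ofScalars_series_injective ℂ ℂ this
  simp only [tay, this]

lemma tay_const (a : ℂ) : tay (fun _ => a) = C a := by
  ext n
  simp only [tay, coeff_mk, coeff_C, iteratedDeriv_const]
  split_ifs with h <;> simp [h]

lemma tay_id : tay (fun w => w) = X := by
  ext n
  simp only [tay, coeff_mk, coeff_X]
  rcases n with _ | _ | n
  · simp
  · simp [iteratedDeriv_one]
  · have : iteratedDeriv (n + 1 + 1) (fun w : ℂ => w) 0 = 0 := by
      rw [iteratedDeriv_succ', iteratedDeriv_succ']
      simp
    simp [this]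

lemma tay_zero {F : ℂ → ℂ} (hF : AnalyticAt ℂ F 0) (h : tay F = 0) :
    F =ᶠ[nhds 0] 0 := by
  have h2 := hF.hasFPowerSeriesAt
  have : (fun n => iteratedDeriv n F 0 / (n.factorial : ℂ)) = 0 := by
    ext n
    simpa [tay] using congrArg (coeff n) h
  rw [this, FormalMultilinearSeries.ofScalars_series_eq_zero_of_scalar_zero] at h2
  exact h2.eventually_eq_zero

lemma cCoeff_nonneg (j : ℕ) : 0 ≤ cCoeff j := by
  rcases j with _ | j
  · simp [cCoeff]
  · unfold cCoeff
    have h1 : 0 < Real.Gamma (3 * ((j + 1 : ℕ) : ℝ) / 2 - 1) := by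
      apply Real.Gamma_pos_of_pos
      push_cast
      have : (0 : ℝ) ≤ j := by positivity
      linarith
    have h2 : 0 < Real.Gamma ((j + 1 : ℕ) : ℝ) := Real.Gamma_pos_of_pos (by positivity)
    have h3 : 0 < Real.Gamma (((j + 1 : ℕ) : ℝ) / 2 + 1) := Real.Gamma_pos_of_pos (by positivity)
    positivity

lemma cCoeff_rec (j : ℕ) :
    cCoeff (j + 3) * (2 * (j + 2) * (j + 3)) = 7776 * (9 * (j + 1) ^ 2 - 4) * cCoeff (j + 1) := by
  unfold cCoeff
  have hj : (0 : ℝ) ≤ j := by positivity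
  have e1 : Real.Gamma (3 * ((j + 3 : ℕ) : ℝ) / 2 - 1) =
      (3 * j / 2 + 5 / 2) * ((3 * j / 2 + 3 / 2) * ((3 * j / 2 + 1 / 2) *
        Real.Gamma (3 * ((j + 1 : ℕ) : ℝ) / 2 - 1))) := by
    have a0 : (3 * ((j + 1 : ℕ) : ℝ) / 2 - 1) = 3 * j / 2 + 1 / 2 := by push_cast; ring
    have a1 : (3 * ((j + 3 : ℕ) : ℝ) / 2 - 1) = 3 * j / 2 + 1 / 2 + 1 + 1 + 1 := by
      push_cast; ring
    rw [a0, a1, Real.Gamma_add_one (by positivity), Real.Gamma_add_one (by positivity),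
      Real.Gamma_add_one (by positivity)]
    ring
  have e2 : Real.Gamma ((j + 3 : ℕ) : ℝ) = (j + 2) * ((j + 1) * Real.Gamma ((j + 1 : ℕ) : ℝ)) := by
    have a1 : ((j + 3 : ℕ) : ℝ) = ((j + 1 : ℕ) : ℝ) + 1 + 1 := by push_cast; ring
    rw [a1, Real.Gamma_add_one (by positivity), Real.Gamma_add_one (by positivity)]
    push_cast; ring
  have e3 : Real.Gamma (((j + 3 : ℕ) : ℝ) / 2 + 1) =
      (j / 2 + 3 / 2) * Real.Gamma (((j + 1 : ℕ) : ℝ) / 2 + 1) := by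
    have a1 : ((j + 3 : ℕ) : ℝ) / 2 + 1 = (((j + 1 : ℕ) : ℝ) / 2 + 1) + 1 := by push_cast; ring
    rw [a1, Real.Gamma_add_one (by positivity)]
    push_cast; ring
  have g2 : Real.Gamma ((j + 1 : ℕ) : ℝ) ≠ 0 := (Real.Gamma_pos_of_pos (by positivity)).ne'
  have g3 : Real.Gamma (((j + 1 : ℕ) : ℝ) / 2 + 1) ≠ 0 :=
    (Real.Gamma_pos_of_pos (by positivity)).ne'
  rw [e1, e2, e3]
  generalize Real.Gamma (3 * ((j + 1 : ℕ) : ℝ) / 2 - 1) = A at *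
  generalize Real.Gamma (((j + 1 : ℕ) : ℝ) / 2 + 1) = B at *
  generalize Real.Gamma ((j + 1 : ℕ) : ℝ) = D at *
  have : j + 3 - 1 = j + 2 := by omega
  rw [this, Nat.add_sub_cancel]
  have k1 : (j : ℝ) + 1 ≠ 0 := by positivity
  have k2 : (j : ℝ) + 2 ≠ 0 := by positivity
  have k3 : (j : ℝ) / 2 + 3 / 2 ≠ 0 := by positivity
  field_simp
  ring

lemma cCoeff_step (j : ℕ) : cCoeff (j + 3) ≤ 34992 * cCoeff (j + 1) := by
  have h := cCoeff_rec j
  have h0 := cCoeff_nonneg (j + 1)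
  have hj : (0 : ℝ) ≤ j := by positivity
  have hp : (0 : ℝ) < 2 * (j + 2) * (j + 3) := by positivity
  refine le_of_mul_le_mul_right ?_ hp
  rw [h]
  have : (7776 : ℝ) * (9 * (j + 1) ^ 2 - 4) ≤ 34992 * (2 * (j + 2) * (j + 3)) := by nlinarith
  nlinarith [mul_le_mul_of_nonneg_right this h0]

lemma cCoeff_zero : cCoeff 0 = 0 := by simp [cCoeff]

lemma cCoeff_one : cCoeff 1 = 1 := by
  rw [← V_coeff, V, L, coeff_mk, coeff_succ_X_mul]; simp [phiS_const]

lemma cCoeff_two : cCoeff 2 = 36 := by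
  unfold cCoeff; norm_num

lemma R_sq : (108 * Real.sqrt 3) ^ 2 = 34992 := by
  rw [mul_pow, Real.sq_sqrt (by norm_num)]; norm_num

lemma cCoeff_le (j : ℕ) : cCoeff j ≤ (108 * Real.sqrt 3) ^ j := by
  have h3 : (1 : ℝ) ≤ Real.sqrt 3 := Real.one_le_sqrt.2 (by norm_num)
  induction j using Nat.strong_induction_on with
  | _ j ih =>
    rcases j with _ | _ | _ | j
    · simp [cCoeff_zero]
    · norm_num [cCoeff_one]; linarith
    · rw [R_sq, cCoeff_two]; norm_num
    · refine (cCoeff_step j).trans ?_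
      have := ih (j + 1) (by omega)
      rw [show j + 1 + 1 + 1 = (j + 1) + 2 from rfl, pow_add _ (j + 1), R_sq]
      linarith

lemma V_fps : HasFPowerSeriesOnBall vFun
    (FormalMultilinearSeries.ofScalars ℂ (fun n => (cCoeff n : ℂ))) 0
      (ENNReal.ofReal (Real.sqrt 3 / 324)) := by
  set p := FormalMultilinearSeries.ofScalars ℂ (fun n => (cCoeff n : ℂ)) with hp
  have hr : ENNReal.ofReal (Real.sqrt 3 / 324) ≤ p.radius := by
    apply p.le_radius_of_bound 1
    intro n
    rw [hp, FormalMultilinearSeries.ofScalars_norm, Complex.norm_real, Real.norm_eq_abs,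
      abs_of_nonneg (cCoeff_nonneg n), Real.coe_toNNReal _ (by positivity)]
    calc cCoeff n * (Real.sqrt 3 / 324) ^ n
        ≤ (108 * Real.sqrt 3) ^ n * (Real.sqrt 3 / 324) ^ n := by
          gcongr; exact cCoeff_le n
      _ = 1 := by
          rw [← mul_pow]
          have : 108 * Real.sqrt 3 * (Real.sqrt 3 / 324) = 1 := by
            have := Real.mul_self_sqrt (show (0 : ℝ) ≤ 3 by norm_num)
            linarith
          rw [this, one_pow]
  have hpos : 0 < ENNReal.ofReal (Real.sqrt 3 / 324) := by
    rw [ENNReal.ofReal_pos]; positivity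
  have h1 := (p.hasFPowerSeriesOnBall (hpos.trans_le hr)).mono hpos hr
  refine h1.congr ?_
  intro w hw
  have hs := h1.hasSum hw
  simp only [zero_add] at hs
  have hs' : HasSum (fun n => (cCoeff n : ℂ) * w ^ n) (p.sum w) := by
    simpa [hp, FormalMultilinearSeries.ofScalars_apply_eq, mul_comm] using hs
  rw [← hasSum_nat_add_iff' 1] at hs'
  simp [cCoeff_zero] at hs'
  exact hs'.tsum_eq.symm

lemma vFun_analytic : AnalyticOnNhd ℂ vFun (Metric.ball (0 : ℂ) (Real.sqrt 3 / 324)) := by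
  have := V_fps.analyticOnNhd
  rwa [Metric.eball_ofReal] at this

lemma zero_mem : (0 : ℂ) ∈ Metric.ball (0 : ℂ) (Real.sqrt 3 / 324) := by
  simp

noncomputable def iC : PowerSeries ℝ →+* PowerSeries ℂ := PowerSeries.map (algebraMap ℝ ℂ)

lemma iC_C (a : ℝ) : iC (C a) = C (a : ℂ) := by simp [iC]

lemma iC_X : iC X = X := by simp [iC]

lemma tay_v : tay vFun = iC V := by
  rw [tay_eq V_fps.hasFPowerSeriesAt]
  ext n
  simp [iC, V_coeff]

lemma vFun_cubic_near : (fun w => 72 * (vFun w * vFun w * vFun w) + (-1) * (vFun w * vFun w) + w * w)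
    =ᶠ[nhds 0] 0 := by
  have hv : AnalyticAt ℂ vFun 0 := vFun_analytic 0 zero_mem
  have hid : AnalyticAt ℂ (fun w : ℂ => w) 0 := analyticAt_id
  apply tay_zero (by fun_prop)
  rw [tay_add (by fun_prop) (by fun_prop), tay_add (by fun_prop) (by fun_prop),
    tay_mul (by fun_prop) (by fun_prop), tay_mul (by fun_prop) (by fun_prop),
    tay_mul (by fun_prop) (by fun_prop), tay_mul (by fun_prop) (by fun_prop),
    tay_mul (by fun_prop) (by fun_prop), tay_const, tay_const,
    tay_mul hid hid, tay_id, tay_v]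
  have := congrArg iC V_cubic
  simp only [map_add, map_sub, map_mul, map_pow, iC_C, iC_X, map_zero] at this
  have e : C (-1 : ℂ) = -1 := by simp
  push_cast at this
  rw [e]
  linear_combination this

lemma vFun_cubic {w : ℂ} (hw : w ∈ Metric.ball (0 : ℂ) (Real.sqrt 3 / 324)) :
    72 * (vFun w * vFun w * vFun w) + (-1) * (vFun w * vFun w) + w * w = 0 := by
  have ha : AnalyticOnNhd ℂ (fun w => 72 * (vFun w * vFun w * vFun w) +
      (-1) * (vFun w * vFun w) + w * w) (Metric.ball (0 : ℂ) (Real.sqrt 3 / 324)) := by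
    intro z hz
    have hv : AnalyticAt ℂ vFun z := vFun_analytic z hz
    fun_prop
  have := ha.eqOn_zero_of_preconnected_of_eventuallyEq_zero
    (convex_ball _ _).isPreconnected zero_mem vFun_cubic_near
  exact this hw

lemma vFun_ne {w : ℂ} (hw : w ∈ Metric.ball (0 : ℂ) (Real.sqrt 3 / 324)) :
    1 - 108 * vFun w ≠ 0 := by
  intro h
  have hv : vFun w = 1 / 108 := by linear_combination (-1 / 108 : ℂ) * h
  have hc := vFun_cubic hw
  rw [hv] at hc
  have hw2 : w ^ 2 = 1 / 34992 := by linear_combination hc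
  have hn : ‖w‖ ^ 2 = 1 / 34992 := by
    rw [← norm_pow, hw2]; norm_num
  have hlt : ‖w‖ < Real.sqrt 3 / 324 := by simpa using hw
  have h3 := Real.sq_sqrt (show (0 : ℝ) ≤ 3 by norm_num)
  have : ‖w‖ ^ 2 < (Real.sqrt 3 / 324) ^ 2 := by gcongr
  rw [hn, div_pow, h3] at this
  norm_num at this

lemma gHat2_analytic : AnalyticOnNhd ℂ gHat2 (Metric.ball (0 : ℂ) (Real.sqrt 3 / 324)) := by
  intro z hz
  have hv : AnalyticAt ℂ vFun z := vFun_analytic z hz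
  have hne := vFun_ne hz
  unfold gHat2
  apply AnalyticAt.div (by fun_prop) (by fun_prop)
  exact pow_ne_zero _ hne

lemma tay_congr {F G : ℂ → ℂ} (h : F =ᶠ[nhds 0] G) : tay F = tay G := by
  ext n
  simp only [tay, coeff_mk, h.iteratedDeriv_eq n]

lemma V_const : constantCoeff V = 0 := by
  rw [← coeff_zero_eq_constantCoeff_apply, V_coeff, cCoeff_zero]

lemma tay_g : ∃ G : PowerSeries ℝ, tay gHat2 = iC G ∧
    G * (1 - C 108 * V) ^ 4 = C 162 * V * (C 5 - C 324 * V) := by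
  refine ⟨C 162 * V * (C 5 - C 324 * V) * ((1 - C 108 * V) ^ 4)⁻¹, ?_, ?_⟩
  swap
  · rw [mul_assoc, PowerSeries.inv_mul_cancel, mul_one]
    simp [V_const]
  · set G := C 162 * V * (C 5 - C 324 * V) * ((1 - C 108 * V) ^ 4)⁻¹ with hG
    have h1 : G * (1 - C 108 * V) ^ 4 = C 162 * V * (C 5 - C 324 * V) := by
      rw [hG, mul_assoc, PowerSeries.inv_mul_cancel, mul_one]
      simp [V_const]
    have h2 := congrArg iC h1
    simp only [map_sub, map_mul, map_pow, iC_C, map_one] at h2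
    push_cast at h2
    have hne : (1 - C (108 : ℂ) * iC V) ≠ 0 := by
      intro h
      have := congrArg (coeff 0) h
      have hV0 : coeff 0 (iC V) = 0 := by
        rw [iC, coeff_map, V_coeff, cCoeff_zero]; simp
      rw [map_sub, coeff_C_mul, hV0] at this
      simp at this
    apply mul_right_cancel₀ (pow_ne_zero 4 hne)
    rw [h2]
    have hv : AnalyticAt ℂ vFun 0 := vFun_analytic 0 zero_mem
    have hg : AnalyticAt ℂ gHat2 0 := gHat2_analytic 0 zero_mem
    have hev : (fun w => gHat2 w * ((1 + (-108) * vFun w) * (1 + (-108) * vFun w) *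
        (1 + (-108) * vFun w) * (1 + (-108) * vFun w))) =ᶠ[nhds 0]
        (fun w => 162 * vFun w * (5 + (-324) * vFun w)) := by
      filter_upwards [Metric.isOpen_ball.mem_nhds zero_mem] with w hw
      have := vFun_ne hw
      unfold gHat2
      have e : (1 + (-108) * vFun w) * (1 + (-108) * vFun w) *
        (1 + (-108) * vFun w) * (1 + (-108) * vFun w) = (1 - 108 * vFun w) ^ 4 := by ring
      rw [e, div_mul_cancel₀ _ (pow_ne_zero 4 this)]
      ring
    have h3 := tay_congr hev
    have k1 : tay (fun w => 1 + (-108) * vFun w) = 1 - C 108 * iC V := by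
      rw [tay_add (by fun_prop) (by fun_prop), tay_mul (by fun_prop) (by fun_prop), tay_const,
        tay_const, tay_v, map_neg, map_one]
      ring
    have k2 : tay (fun w => 162 * vFun w * (5 + (-324) * vFun w)) =
        C 162 * iC V * (C 5 - C 324 * iC V) := by
      rw [tay_mul (by fun_prop) (by fun_prop), tay_mul (by fun_prop) (by fun_prop),
        tay_add (by fun_prop) (by fun_prop), tay_mul (by fun_prop) (by fun_prop), tay_const,
        tay_const, tay_const, tay_v, map_neg]
      ring
    rw [k2, tay_mul (by fun_prop) (by fun_prop), tay_mul (by fun_prop) (by fun_prop),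
      tay_mul (by fun_prop) (by fun_prop), tay_mul (by fun_prop) (by fun_prop), k1] at h3
    rw [← h3]
    ring

end analytic

/-- `ĝ₂` is analytic on the disk `|w| < w_c = √3/324` and its Taylor coefficient of order
`j ≥ 1` at `w = 0` equals
`162 · 72^{j-1} ∑_{m=0}^{j-1} Γ(3j/2 - m)/(Γ(j-m) Γ(j/2+1)) (m+1)(m+5) (3/2)^m`. -/
theorem stmt11 :
    AnalyticOnNhd ℂ gHat2 (Metric.ball (0 : ℂ) (Real.sqrt 3 / 324)) ∧
    ∀ j : ℕ, 1 ≤ j →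
      iteratedDeriv j gHat2 0 / (Nat.factorial j : ℂ) =
        ((162 * 72 ^ (j - 1) *
          ∑ m ∈ Finset.range j,
            Real.Gamma (3 * j / 2 - m) /
              (Real.Gamma (j - m) * Real.Gamma (j / 2 + 1)) *
            ((m + 1) * (m + 5)) * (3 / 2) ^ m : ℝ) : ℂ) := by
  refine ⟨gHat2_analytic, ?_⟩
  intro j hj
  obtain ⟨G, h1, h2⟩ := tay_g
  rw [← G_coeff G h2 j hj]
  have := congrArg (PowerSeries.coeff j) h1
  simpa [tay, iC] using this
end

section
/- Let $u_c = \frac{3^{1/4}}{18}$ and, for each integer $j \geq 1$, let $f^{(0)}_{2j} = \frac{72^j\,\Gamma(\tfrac{3j}{2})\,(2j)!}{2\,\Gamma(j+3)\,\Gamma(\tfrac{j}{2}+1)}$, where $\Gamma$ is the Euler Gamma function. Then $\lim_{j \to \infty} \frac{f^{(0)}_{2j}\, u_c^{2j}\, j^{7/2}}{(2j)!} = \frac{1}{\sqrt{6\pi}}$. -/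
/-- Genus-zero coefficients `f⁽⁰⁾₂ⱼ = 72^j Γ(3j/2) (2j)! / (2 Γ(j+3) Γ(j/2+1))`. -/
noncomputable def f0 (j : ℕ) : ℝ :=
  72 ^ j * Real.Gamma (3 * j / 2) * Nat.factorial (2 * j) /
    (2 * Real.Gamma (j + 3) * Real.Gamma (j / 2 + 1))

open Filter Topology in
lemma aux_R : Tendsto (fun x : ℝ => Real.Gamma (x + 1/2) / (Real.Gamma x * √x)) atTop (𝓝 1) := by
  have key : ∀ x : ℝ, 0 < x → Real.Gamma (x + 1/2) ≤ √x * Real.Gamma x := by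
    intro x hx
    have h := Real.Gamma_mul_add_mul_le_rpow_Gamma_mul_rpow_Gamma (s := x) (t := x + 1)
      (a := 1/2) (b := 1/2) hx (by linarith) (by norm_num) (by norm_num) (by norm_num)
    have hg := Real.Gamma_pos_of_pos hx
    rw [Real.Gamma_add_one hx.ne', ← Real.sqrt_eq_rpow, ← Real.sqrt_eq_rpow,
      Real.sqrt_mul hx.le] at h
    have e : 1/2 * x + 1/2 * (x+1) = x + 1/2 := by ring
    rw [e] at h
    calc _ ≤ _ := h
      _ = √x * (√(Real.Gamma x) * √(Real.Gamma x)) := by ring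
      _ = _ := by rw [Real.mul_self_sqrt hg.le]
  have hlim : Tendsto (fun x : ℝ => √(x / (x + 1/2))) atTop (𝓝 1) := by
    have h0 : Tendsto (fun x : ℝ => 1 - (1/2) / (x + 1/2)) atTop (𝓝 (1 - 0)) :=
      tendsto_const_nhds.sub
        (tendsto_const_nhds.div_atTop (tendsto_atTop_add_const_right _ _ tendsto_id))
    have h1 : Tendsto (fun x : ℝ => x / (x + 1/2)) atTop (𝓝 1) := by
      rw [sub_zero] at h0
      refine h0.congr' ?_
      filter_upwards [eventually_gt_atTop 0] with x hx
      field_simp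
      ring
    simpa using h1.sqrt
  refine tendsto_of_tendsto_of_tendsto_of_le_of_le' hlim tendsto_const_nhds ?_ ?_
  · filter_upwards [eventually_gt_atTop 0] with x hx
    have hg := Real.Gamma_pos_of_pos hx
    have h := key (x + 1/2) (by linarith)
    have e : x + 1/2 + 1/2 = x + 1 := by ring
    rw [e, Real.Gamma_add_one hx.ne'] at h
    have hs : 0 < √x := Real.sqrt_pos.2 hx
    have hs2 : 0 < √(x + 1/2) := Real.sqrt_pos.2 (by linarith)
    rw [Real.sqrt_div hx.le, div_le_div_iff₀ hs2 (by positivity)]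
    calc _ = (√x * √x) * Real.Gamma x := by ring
      _ = x * Real.Gamma x := by rw [Real.mul_self_sqrt hx.le]
      _ ≤ _ := h
      _ = _ := by ring
  · filter_upwards [eventually_gt_atTop 0] with x hx
    have hg := Real.Gamma_pos_of_pos hx
    have hs : 0 < √x := Real.sqrt_pos.2 hx
    rw [div_le_one (by positivity)]
    linarith [key x hx]

noncomputable def auxA (n : ℕ) : ℝ :=
  Real.Gamma ((n:ℝ)/2 + 1)^2 * 2^n / (n.factorial * √Real.pi * √(((n:ℝ)+1)/2))

open Filter Topology in
lemma aux_A : Tendsto auxA atTop (𝓝 1) := by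
  have hx : Tendsto (fun n : ℕ => ((n:ℝ)+1)/2) atTop atTop :=
    (tendsto_atTop_add_const_right _ _ tendsto_natCast_atTop_atTop).atTop_div_const (by norm_num)
  refine (aux_R.comp hx).congr ?_
  intro n
  have hp : (0:ℝ) < ((n:ℝ)+1)/2 := by positivity
  have hg := Real.Gamma_pos_of_pos hp
  have h := Real.Gamma_mul_Gamma_add_half (((n:ℝ)+1)/2)
  have e1 : ((n:ℝ)+1)/2 + 1/2 = n/2 + 1 := by ring
  have e2 : 2 * (((n:ℝ)+1)/2) = n + 1 := by ring
  have e3 : (1:ℝ) - (n + 1) = -(n:ℝ) := by ring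
  rw [e1, e2, e3, Real.Gamma_nat_eq_factorial, Real.rpow_neg (by norm_num), Real.rpow_natCast] at h
  have hs : 0 < √(((n:ℝ)+1)/2) := Real.sqrt_pos.2 hp
  have hpi : 0 < √Real.pi := Real.sqrt_pos.2 Real.pi_pos
  have hf : (0:ℝ) < n.factorial := by exact_mod_cast n.factorial_pos
  simp only [Function.comp, auxA, e1]
  rw [div_eq_div_iff (by positivity) (by positivity)]
  have h2 : (n.factorial : ℝ) * √Real.pi =
      Real.Gamma (((n:ℝ)+1)/2) * Real.Gamma ((n:ℝ)/2+1) * 2^n := by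
    rw [h]; field_simp
  rw [h2]; ring

open Filter Topology in
lemma aux_F : Tendsto (fun j : ℕ => ((3*j).factorial : ℝ) / ((j.factorial:ℝ)^3 * 27^j) * j)
    atTop (𝓝 (√3 / (2 * Real.pi))) := by
  have h3 : Tendsto (fun j : ℕ => 3 * j) atTop atTop :=
    tendsto_id.const_mul_atTop' (by norm_num)
  have hS := Stirling.tendsto_stirlingSeq_sqrt_pi
  have hpi : 0 < √Real.pi := Real.sqrt_pos.2 Real.pi_pos
  have h := ((hS.comp h3).div (hS.pow 3) (by positivity)).mul_const (√3 / 2)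
  have e : √Real.pi / √Real.pi ^ 3 * (√3/2) = √3 / (2 * Real.pi) := by
    have : √Real.pi ^ 3 = √Real.pi * Real.pi := by
      rw [pow_succ, Real.sq_sqrt Real.pi_pos.le]; ring
    rw [this]; field_simp
  rw [e] at h
  refine h.congr' ?_
  filter_upwards [eventually_gt_atTop 0] with j hj
  have hj' : (0:ℝ) < j := by exact_mod_cast hj
  simp only [Function.comp, Stirling.stirlingSeq, Pi.div_apply]
  push_cast
  have e1 : √(2 * (3 * (j:ℝ))) = √3 * √(2*j) := by
    rw [← Real.sqrt_mul (by norm_num)]; congr 1; ring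
  have e2 : (3 * (j:ℝ) / Real.exp 1) ^ (3*j) = 27^j * ((j / Real.exp 1)^j)^3 := by
    rw [mul_div_assoc, mul_pow, pow_mul, ← pow_mul _ j 3, mul_comm j 3]; norm_num
  rw [e1, e2]
  have hs : 0 < √(2*(j:ℝ)) := Real.sqrt_pos.2 (by positivity)
  have hs2 : √(2*(j:ℝ))^2 = 2*j := Real.sq_sqrt (by positivity)
  have hE : 0 < ((j:ℝ) / Real.exp 1)^j := by positivity
  have hf : (0:ℝ) < j.factorial := by exact_mod_cast j.factorial_pos
  generalize ((j:ℝ) / Real.exp 1)^j = E at *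
  generalize √(2*(j:ℝ)) = s at *
  field_simp
  rw [hs2]
  try ring

open Filter Topology in
lemma aux_sq : Tendsto (fun j : ℕ =>
      (f0 j * ((3 : ℝ) ^ ((1 : ℝ) / 4) / 18) ^ (2 * j) * (j : ℝ) ^ ((7 : ℝ) / 2) /
          Nat.factorial (2 * j))^2) atTop (𝓝 (1 / (6 * Real.pi))) := by
  have h3 : Tendsto (fun j : ℕ => 3 * j) atTop atTop :=
    tendsto_id.const_mul_atTop' (by norm_num)
  have hinv : ∀ c : ℝ, Tendsto (fun j : ℕ => c / ((j:ℝ))) atTop (𝓝 0) := fun c =>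
    tendsto_const_nhds.div_atTop tendsto_natCast_atTop_atTop
  have hq : Tendsto (fun j : ℕ => √((3 + 1/(j:ℝ))/(1 + 1/(j:ℝ)))) atTop (𝓝 √3) := by
    have := (((hinv 1).const_add 3).div ((hinv 1).const_add 1) (by norm_num)).sqrt
    simpa using this
  have hr : Tendsto (fun j : ℕ => (1 / ((1 + 1/(j:ℝ)) * (1 + 2/(j:ℝ))))^2) atTop (𝓝 1) := by
    have := ((tendsto_const_nhds (x := (1:ℝ))).div (((hinv 1).const_add 1).mul
      ((hinv 2).const_add 1)) (by norm_num)).pow 2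
    simpa using this
  have h := (((((aux_A.comp h3).div aux_A one_ne_zero).mul hq).mul aux_F).mul hr).mul_const (1/9)
  have e : (1:ℝ) / 1 * √3 * (√3 / (2 * Real.pi)) * 1 * (1/9) = 1 / (6 * Real.pi) := by
    have : √3 * √3 = (3:ℝ) := Real.mul_self_sqrt (by norm_num)
    field_simp
    nlinarith
  rw [e] at h
  refine h.congr' ?_
  filter_upwards [eventually_gt_atTop 0] with j hj
  have hj' : (0:ℝ) < j := by exact_mod_cast hj
  have hu : (((3 : ℝ) ^ ((1 : ℝ) / 4) / 18) ^ (2 * j))^2 = (3/18^4)^j := by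
    have h4 : ((3 : ℝ) ^ ((1 : ℝ) / 4))^4 = 3 := by
      rw [← Real.rpow_natCast, ← Real.rpow_mul (by norm_num)]
      norm_num
    rw [← pow_mul, show 2 * j * 2 = 4 * j by ring, pow_mul, div_pow, h4]
  have h7 : ((j : ℝ) ^ ((7 : ℝ) / 2))^2 = (j:ℝ)^7 := by
    rw [← Real.rpow_natCast, ← Real.rpow_mul hj'.le, ← Real.rpow_natCast]; norm_num
  have hG : Real.Gamma (3 * (j:ℝ)/2 + 1) = (3 * (j:ℝ)/2) * Real.Gamma (3 * (j:ℝ)/2) :=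
    Real.Gamma_add_one (by positivity)
  have hG3 : Real.Gamma ((j:ℝ) + 3) = (j+2) * (j+1) * j.factorial := by
    rw [show (j:ℝ) + 3 = (j + 1 + 1) + 1 by ring, Real.Gamma_add_one (by positivity),
      Real.Gamma_add_one (by positivity), Real.Gamma_nat_eq_factorial]; ring
  have hg1 : 0 < Real.Gamma (3 * (j:ℝ)/2) := Real.Gamma_pos_of_pos (by positivity)
  have hg2 : 0 < Real.Gamma ((j:ℝ)/2 + 1) := Real.Gamma_pos_of_pos (by positivity)
  have hpi : 0 < √Real.pi := Real.sqrt_pos.2 Real.pi_pos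
  have hf : (0:ℝ) < j.factorial := by exact_mod_cast j.factorial_pos
  have hf3 : (0:ℝ) < (3*j).factorial := by exact_mod_cast (3*j).factorial_pos
  have hf2 : (0:ℝ) < (2*j).factorial := by exact_mod_cast (2*j).factorial_pos
  have hsq : √((3 + 1/(j:ℝ))/(1 + 1/(j:ℝ))) = √((3 * (j:ℝ)+1)/2) / √(((j:ℝ)+1)/2) := by
    rw [← Real.sqrt_div (by positivity)]; congr 1; field_simp
  have hs1 : 0 < √((3 * (j:ℝ)+1)/2) := Real.sqrt_pos.2 (by positivity)
  have hs2 : 0 < √(((j:ℝ)+1)/2) := Real.sqrt_pos.2 (by positivity)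
  have hp2 : (2:ℝ)^(3*j) = 2^j * 4^j := by
    rw [pow_mul, ← mul_pow]; norm_num
  have h27 : ((72:ℝ)^j)^2 * (3/18^4)^j = 4^j / 27^j := by
    rw [← pow_mul, mul_comm j 2, pow_mul, ← mul_pow, ← div_pow]; norm_num
  simp only [Function.comp, auxA, Pi.div_apply, f0]
  push_cast
  rw [hsq, hG, hG3, hp2]
  simp only [mul_pow, div_pow _ _ 2, hu, h7]
  have h27' : (3/18^4 : ℝ)^j = 4^j / 27^j / ((72:ℝ)^j)^2 := by
    rw [← h27]; field_simp
  rw [h27']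
  generalize √((3 * (j:ℝ)+1)/2) = s1 at *
  generalize √(((j:ℝ)+1)/2) = s2 at *
  generalize Real.Gamma (3 * (j:ℝ)/2) = g1 at *
  generalize Real.Gamma ((j:ℝ)/2 + 1) = g2 at *
  have p1 : (0:ℝ) < 72^j := by positivity
  have p2 : (0:ℝ) < 27^j := by positivity
  have p3 : (0:ℝ) < 4^j := by positivity
  have p4 : (0:ℝ) < 2^j := by positivity
  clear hu h27 h27' hp2 h
  generalize (72:ℝ)^j = a at *
  generalize (27:ℝ)^j = b at *
  generalize (4:ℝ)^j = c at *
  generalize (2:ℝ)^j = d at *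
  field_simp
  try ring

theorem stmt12 :
    Filter.Tendsto
      (fun j : ℕ =>
        f0 j * ((3 : ℝ) ^ ((1 : ℝ) / 4) / 18) ^ (2 * j) * (j : ℝ) ^ ((7 : ℝ) / 2) /
          Nat.factorial (2 * j))
      Filter.atTop (nhds (1 / Real.sqrt (6 * Real.pi))) := by
  have h := aux_sq.sqrt
  rw [Real.sqrt_div zero_le_one, Real.sqrt_one] at h
  refine h.congr' ?_
  filter_upwards [Filter.eventually_gt_atTop 0] with j hj
  have hj' : (0:ℝ) < j := by exact_mod_cast hj
  apply Real.sqrt_sq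
  have hg1 : 0 < Real.Gamma (3 * (j:ℝ)/2) := Real.Gamma_pos_of_pos (by positivity)
  have hg2 : 0 < Real.Gamma ((j:ℝ)/2 + 1) := Real.Gamma_pos_of_pos (by positivity)
  have hg3 : 0 < Real.Gamma ((j:ℝ) + 3) := Real.Gamma_pos_of_pos (by positivity)
  unfold f0
  positivity
end

section
/- Let $u_c = \frac{3^{1/4}}{18}$ and, for each integer $j \geq 1$, define $c_j = 162 \cdot 72^{j-1} \sum_{m=0}^{j-1} \frac{\Gamma(\tfrac{3j}{2}-m)}{\Gamma(j-m)\,\Gamma(\tfrac{j}{2}+1)}\,(m+1)(m+5)\left(\frac{3}{2}\right)^m$ and $f^{(2)}_{2j} = \frac{c_j\,(2j)!}{108\, j\,(3j+2)}$, where $\Gamma$ is the Euler Gamma function. Then $\lim_{j \to \infty} \frac{f^{(2)}_{2j}\, u_c^{2j}\, j}{(2j)!} = \frac{1}{48}$. -/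
/-- The Taylor coefficients `c_j` of the genus-one term `ĝ₂(w)`. -/
noncomputable def cGenusOne (j : ℕ) : ℝ :=
  162 * 72 ^ (j - 1) *
    ∑ m ∈ Finset.range j,
      Real.Gamma (3 * j / 2 - m) / (Real.Gamma (j - m) * Real.Gamma (j / 2 + 1)) *
        ((m + 1) * (m + 5)) * (3 / 2) ^ m

/-- Genus-one coefficients `f⁽²⁾₂ⱼ = c_j (2j)! / (108 j (3j+2))`. -/
noncomputable def f2 (j : ℕ) : ℝ :=
  cGenusOne j * Nat.factorial (2 * j) / (108 * j * (3 * j + 2))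

open Real MeasureTheory Filter Topology

lemma beta_sum (s : ℝ) (hs : 1 ≤ s) (x : ℝ) (hx : 0 < x) (j : ℕ) :
    Gamma (s + (j + 1)) / (Gamma s * Gamma (j + 1)) * ∫ t in (0:ℝ)..x, t ^ (s - 1) * (1 - t) ^ j
      = ∑ n ∈ Finset.range (j + 1), Gamma (s + n) / (Gamma s * Gamma (n + 1)) * x ^ s * (1 - x) ^ n := by
  have hs0 : 0 < s := by linarith
  have hG : Gamma s ≠ 0 := (Gamma_pos_of_pos hs0).ne'
  have hcont : Continuous fun t : ℝ => t ^ (s - 1) := continuous_id.rpow_const (fun _ => Or.inr (by linarith))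
  have hconts : Continuous fun t : ℝ => t ^ s := continuous_id.rpow_const (fun _ => Or.inr (by linarith))
  have hint : ∀ i : ℕ, IntervalIntegrable (fun t : ℝ => t ^ (s - 1) * (1 - t) ^ i) volume 0 x := fun i =>
    (by fun_prop : Continuous fun t : ℝ => t ^ (s - 1) * (1 - t) ^ i).intervalIntegrable _ _
  induction j with
  | zero =>
    simp
    rw [integral_rpow (Or.inl (by linarith)), Gamma_add_one hs0.ne']
    have : s - 1 + 1 = s := by ring
    rw [this, zero_rpow hs0.ne']
    field_simp
    ring
  | succ j ih =>
    rw [Finset.sum_range_succ, ← ih]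
    have key : x ^ s * (1 - x) ^ (j + 1) = (s + (j + 1)) * (∫ t in (0:ℝ)..x, t ^ (s - 1) * (1 - t) ^ (j + 1))
        - (j + 1) * ∫ t in (0:ℝ)..x, t ^ (s - 1) * (1 - t) ^ j := by
      rw [← intervalIntegral.integral_const_mul, ← intervalIntegral.integral_const_mul,
        ← intervalIntegral.integral_sub ((hint _).const_mul _) ((hint _).const_mul _)]
      have := intervalIntegral.integral_eq_sub_of_hasDerivAt (a := 0) (b := x)
        (f := fun t : ℝ => t ^ s * (1 - t) ^ (j + 1))
        (f' := fun t : ℝ => (s + (j + 1)) * (t ^ (s - 1) * (1 - t) ^ (j + 1)) - (j + 1) * (t ^ (s - 1) * (1 - t) ^ j))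
        (by
          intro t ht
          rw [Set.uIcc_of_le hx.le] at ht
          have h1 := hasDerivAt_rpow_const (x := t) (p := s) (Or.inr hs)
          have h2 := ((hasDerivAt_id t).const_sub 1).pow (j + 1)
          have h3 := h1.mul h2
          refine h3.congr_deriv ?_
          have h4 : t ^ s = t * t ^ (s - 1) := by
            rcases ht.1.eq_or_lt with h | h
            · rw [← h, zero_rpow hs0.ne']; simp
            · rw [rpow_sub_one h.ne']; field_simp
          simp only [id, Pi.pow_apply, h4]
          push_cast
          simp
          ring)
        (((hint _).const_mul _).sub ((hint _).const_mul _))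
      rw [this]
      simp [zero_rpow hs0.ne']
    have hp : (0:ℝ) < s + (j + 1) := by positivity
    have hj : (0:ℝ) < (j:ℝ) + 1 := by positivity
    have e1 : Gamma (s + ((j + 1 : ℕ) + 1)) = (s + (j + 1)) * Gamma (s + (j + 1)) := by
      rw [← Gamma_add_one hp.ne']; push_cast; ring_nf
    have e2 : Gamma (((j + 1 : ℕ) : ℝ) + 1) = (j + 1) * Gamma ((j:ℝ) + 1) := by
      rw [← Gamma_add_one hj.ne']; push_cast; rfl
    have hGj : Gamma ((j:ℝ) + 1) ≠ 0 := (Gamma_pos_of_pos hj).ne'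
    rw [mul_assoc _ (x ^ s), key, e1, e2]
    push_cast
    field_simp
    ring

lemma gosper (j : ℕ) :
    ∑ m ∈ Finset.range j,
      Gamma (3 * j / 2 - m) / (Gamma (j - m) * Gamma (j / 2 + 1)) * ((m + 1) * (m + 5)) * (3 / 2) ^ m
    = (3 * j + 2) * ∑ m ∈ Finset.range j,
      Gamma (3 * j / 2 - m) / (Gamma (j - m) * Gamma (j / 2 + 1)) * (3 / 2) ^ m := by
  set G : ℕ → ℝ := fun m => Gamma (3 * j / 2 - m) / (Gamma (j - m) * Gamma (j / 2 + 1)) * (3 / 2) ^ m with hGdef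
  have hG : ∀ m ∈ Finset.range j, (3 * (j:ℝ) / 2 - m - 1) * G (m + 1) = 3 / 2 * (j - m - 1) * G m := by
    intro m hm
    have hm' : m + 1 ≤ j := Finset.mem_range.mp hm
    have hmr : (m:ℝ) + 1 ≤ j := by exact_mod_cast hm'
    have hm0 : (0:ℝ) ≤ m := by positivity
    simp only [hGdef]
    push_cast
    have e1 : Gamma (3 * (j:ℝ) / 2 - m) = (3 * (j:ℝ) / 2 - m - 1) * Gamma (3 * (j:ℝ) / 2 - (m + 1)) := by
      have := Gamma_add_one (s := 3 * (j:ℝ) / 2 - m - 1) (by nlinarith)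
      rw [show 3 * (j:ℝ) / 2 - (m + 1) = 3 * (j:ℝ) / 2 - m - 1 by ring, ← this]; ring_nf
    rcases hmr.eq_or_lt with h | h
    · have : (j:ℝ) - (m + 1) = 0 := by linarith
      have h2 : (j:ℝ) - m - 1 = 0 := by linarith
      rw [this, h2]; simp
    · have hpos : (0:ℝ) < j - (m + 1) := by linarith
      have e2 : Gamma ((j:ℝ) - m) = (j - (m + 1)) * Gamma ((j:ℝ) - (m + 1)) := by
        rw [← Gamma_add_one hpos.ne']; ring_nf
      have : Gamma ((j:ℝ) - (m + 1)) ≠ 0 := (Gamma_pos_of_pos hpos).ne'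
      have h3 : Gamma ((j:ℝ) / 2 + 1) ≠ 0 := (Gamma_pos_of_pos (by positivity)).ne'
      rw [e1, e2, show (j:ℝ) - m - 1 = j - (m + 1) by ring]
      have := hpos.ne'
      rw [pow_succ]
      field_simp
  have hGj : G j = 0 := by simp [hGdef]
  have tel := Finset.sum_range_sub' (fun m : ℕ => (m:ℝ) * ((3 * (j:ℝ) / 2 - m) * G m)) j
  simp only [hGj, mul_zero, Nat.cast_zero, zero_mul, sub_zero] at tel
  have tel2 := congrArg (fun z : ℝ => 2 * z) tel
  simp only [mul_zero] at tel2
  rw [Finset.mul_sum, ← sub_eq_zero, ← Finset.sum_sub_distrib]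
  refine Eq.trans ?_ tel2
  rw [Finset.mul_sum]
  refine Finset.sum_congr rfl fun m hm => ?_
  have := hG m hm
  have e : (3 * (j:ℝ) / 2 - ((m + 1 : ℕ):ℝ)) * G (m + 1) = 3 / 2 * (j - m - 1) * G m := by
    rw [← this]; push_cast; ring
  rw [e]
  have e' : Gamma (3 * j / 2 - m) / (Gamma (j - m) * Gamma (j / 2 + 1)) * ((m + 1) * (m + 5)) * (3 / 2) ^ m = G m * ((m+1)*(m+5)) := by
    simp only [hGdef]; ring
  rw [e']
  change G m * ((m+1)*(m+5)) - (3 * j + 2) * G m = _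
  push_cast
  ring

/-- rescaled kernel -/
noncomputable def kerF (k : ℕ) (t : ℝ) : ℝ := t ^ ((k + 1 : ℝ) / 2 + 1 - 1) * (1 - t) ^ k

lemma expr_eq_aux (k : ℕ) :
    ∑ m ∈ Finset.range (k + 1),
      Gamma (3 * ((k + 1 : ℕ) : ℝ) / 2 - m) / (Gamma (((k + 1 : ℕ) : ℝ) - m) * Gamma (((k + 1 : ℕ) : ℝ) / 2 + 1)) * (3 / 2) ^ m
    = (3 / 2) ^ k * (3 * 3 ^ ((k + 1 : ℝ) / 2)) * ((∫ t in (0:ℝ)..(1/3), kerF k t) / ∫ t in (0:ℝ)..1, kerF k t) := by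
  have hs : (1:ℝ) ≤ (k + 1 : ℝ) / 2 + 1 := by
    have : (0:ℝ) ≤ k := by positivity
    linarith
  have h1 := beta_sum _ hs 1 one_pos k
  have h2 := beta_sum _ hs (1/3) (by norm_num) k
  have hR : ∑ n ∈ Finset.range (k + 1), Gamma ((k + 1 : ℝ) / 2 + 1 + n) / (Gamma ((k + 1 : ℝ) / 2 + 1) * Gamma (n + 1)) * 1 ^ ((k + 1 : ℝ) / 2 + 1) * (1 - 1) ^ n = 1 := by
    rw [Finset.sum_eq_single 0]
    · simp
      exact (Gamma_pos_of_pos (by linarith)).ne'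
    · intro b _ hb
      simp [hb]
    · simp
  rw [hR] at h1
  change _ * (∫ t in (0:ℝ)..1, kerF k t) = 1 at h1
  change _ * (∫ t in (0:ℝ)..(1/3), kerF k t) = _ at h2
  have hne : (∫ t in (0:ℝ)..1, kerF k t) ≠ 0 := right_ne_zero_of_mul_eq_one h1
  have h3 : (∫ t in (0:ℝ)..(1/3), kerF k t) / (∫ t in (0:ℝ)..1, kerF k t) =
     ∑ n ∈ Finset.range (k + 1), Gamma ((k + 1 : ℝ) / 2 + 1 + n) / (Gamma ((k + 1 : ℝ) / 2 + 1) * Gamma (n + 1)) * (1/3) ^ ((k + 1 : ℝ) / 2 + 1) * (1 - 1/3) ^ n := by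
    rw [← h2, div_eq_iff hne, mul_right_comm, h1, one_mul]
  rw [h3, ← Finset.sum_range_reflect, Finset.mul_sum]
  refine Finset.sum_congr rfl fun n hn => ?_
  have hn' : n ≤ k := by have := Finset.mem_range.mp hn; omega
  have e : k + 1 - 1 - n = k - n := by omega
  rw [e, Nat.cast_sub hn']
  have e3 : (1/3:ℝ) ^ ((k + 1 : ℝ) / 2 + 1) = (3 * 3 ^ ((k + 1 : ℝ) / 2))⁻¹ := by
    rw [one_div, inv_rpow (by norm_num), rpow_add_one (by norm_num), mul_comm]
  have e4 : (3 / 2 : ℝ) ^ k = (3 / 2) ^ (k - n) * (3/2) ^ n := by rw [← pow_add]; congr 1; omega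
  have e5 : ((1:ℝ) - 1/3) ^ n = ((3/2) ^ n)⁻¹ := by rw [← inv_pow]; norm_num
  rw [e3, e4, e5]
  push_cast
  have a1 : 3 * ((k:ℝ) + 1) / 2 - (k - n) = (k + 1) / 2 + 1 + n := by ring
  have a2 : (k:ℝ) + 1 - (k - n) = n + 1 := by ring
  rw [a1, a2]
  have : (3:ℝ) ^ ((k + 1 : ℝ) / 2) ≠ 0 := by positivity
  field_simp

noncomputable def phiF (k : ℕ) (y : ℝ) : ℝ :=
  √(1 + y / √(k + 1)) ^ (k + 1) * (1 - y / √(k + 1) / 2) ^ k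

lemma kerF_eq (k : ℕ) (y : ℝ) (hy : -√(k + 1) ≤ y) :
    kerF k ((3 * √(k + 1))⁻¹ * y + 1 / 3) = (√(1 / 3) ^ (k + 1) * (2 / 3) ^ k) * phiF k y := by
  have hr : 0 < √((k:ℝ) + 1) := by positivity
  unfold kerF phiF
  set r := √((k:ℝ) + 1) with hrdef
  have e1 : (3 * r)⁻¹ * y + 1 / 3 = (1 / 3) * (1 + y / r) := by field_simp; ring
  have e2 : 1 - (1 / 3) * (1 + y / r) = (2 / 3) * (1 - y / r / 2) := by ring
  have hw : 0 ≤ 1 + y / r := by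
    have : -1 ≤ y / r := by rw [le_div_iff₀ hr]; linarith
    linarith
  have e3 : ∀ z : ℝ, 0 ≤ z → z ^ ((k + 1 : ℝ) / 2 + 1 - 1) = √z ^ (k + 1) := by
    intro z hz
    rw [sqrt_eq_rpow, ← rpow_natCast, ← rpow_mul hz]
    congr 1; push_cast; ring
  rw [e1, e2, e3 _ (by positivity), sqrt_mul (by norm_num), mul_pow, mul_pow]
  ring

lemma kerF_integral (k : ℕ) (b : ℝ) (hb : -√(k + 1) ≤ b) :
    ∫ t in (0:ℝ)..((3 * √(k + 1))⁻¹ * b + 1 / 3), kerF k t =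
      (3 * √(k + 1))⁻¹ * (√(1 / 3) ^ (k + 1) * (2 / 3) ^ k) * ∫ y in (-√(k + 1))..b, phiF k y := by
  have hr : 0 < √((k:ℝ) + 1) := by positivity
  have h := intervalIntegral.integral_comp_mul_add (a := -√((k:ℝ) + 1)) (b := b) (kerF k)
    (c := (3 * √((k:ℝ) + 1))⁻¹) (by positivity) (1 / 3)
  have e0 : (3 * √((k:ℝ) + 1))⁻¹ * (-√((k:ℝ) + 1)) + 1 / 3 = 0 := by field_simp; ring
  rw [e0, smul_eq_mul] at h
  have h2 : ∫ y in (-√((k:ℝ) + 1))..b, kerF k ((3 * √(k + 1))⁻¹ * y + 1 / 3) =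
      ∫ y in (-√((k:ℝ) + 1))..b, (√(1 / 3) ^ (k + 1) * (2 / 3) ^ k) * phiF k y := by
    refine intervalIntegral.integral_congr fun y hy => ?_
    rw [Set.uIcc_of_le hb] at hy
    exact kerF_eq k y hy.1
  rw [h2, intervalIntegral.integral_const_mul] at h
  rw [mul_assoc, h]
  field_simp

lemma phiF_bound (k : ℕ) (hk : 1 ≤ k) (y : ℝ) (h1 : -√(k + 1) ≤ y) (h2 : y ≤ 2 * √(k + 1)) :
    |phiF k y| ≤ 2 * exp (-(1 / 16) * y ^ 2) := by
  have hr : 0 < √((k:ℝ) + 1) := by positivity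
  have hr2 : √((k:ℝ) + 1) ^ 2 = k + 1 := sq_sqrt (by positivity)
  unfold phiF
  set r := √((k:ℝ) + 1) with hrdef
  set w := y / r with hw
  have w1 : -1 ≤ w := by rw [hw, le_div_iff₀ hr]; linarith
  have w2 : w ≤ 2 := by rw [hw, div_le_iff₀ hr]; linarith
  have hw1 : 0 ≤ 1 + w := by linarith
  have a1 : √(1 + w) ≤ 2 := by rw [sqrt_le_left (by norm_num)]; linarith
  have a0 : 0 ≤ √(1 + w) * (1 - w / 2) := mul_nonneg (sqrt_nonneg _) (by linarith)
  have a2 : √(1 + w) * (1 - w / 2) ≤ exp (-(w ^ 2 / 8)) := by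
    refine abs_le_of_sq_le_sq' ?_ (exp_pos _).le |>.2
    rw [mul_pow, sq_sqrt hw1, ← exp_nat_mul]
    have := add_one_le_exp (-(w ^ 2 / 4))
    have e : ((2:ℕ):ℝ) * -(w ^ 2 / 8) = -(w ^ 2 / 4) := by push_cast; ring
    rw [e]
    nlinarith [mul_nonneg (sq_nonneg w) (by linarith : 0 ≤ 2 - w)]
  have e : √(1 + w) ^ (k + 1) * (1 - w / 2) ^ k = √(1 + w) * (√(1 + w) * (1 - w / 2)) ^ k := by
    rw [mul_pow, pow_succ]; ring
  rw [e, abs_of_nonneg (by positivity)]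
  refine mul_le_mul a1 ?_ (by positivity) (by norm_num)
  refine (pow_le_pow_left₀ a0 a2 k).trans ?_
  rw [← exp_nat_mul, exp_le_exp]
  have : w ^ 2 = y ^ 2 / (k + 1) := by rw [hw, div_pow, hr2]
  rw [this]
  have hk' : (1:ℝ) ≤ k := by exact_mod_cast hk
  have : (1:ℝ) / 2 ≤ k / (k + 1) := by rw [div_le_div_iff₀ (by norm_num) (by positivity)]; linarith
  have e : (k:ℝ) * -(y ^ 2 / (k + 1) / 8) = -((k / (k + 1)) * (y ^ 2 / 8)) := by field_simp
  rw [e]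
  nlinarith [sq_nonneg y]

lemma r_tendsto : Tendsto (fun k : ℕ => √((k:ℝ) + 1)) atTop atTop :=
  tendsto_sqrt_atTop.comp (tendsto_atTop_add_const_right _ _ tendsto_natCast_atTop_atTop)

lemma phiF_tendsto (y : ℝ) : Tendsto (fun k => phiF k y) atTop (𝓝 (exp (-(3 / 8) * y ^ 2))) := by
  have hw : ∀ c : ℝ, Tendsto (fun k : ℕ => c / √((k:ℝ) + 1)) atTop (𝓝 0) := fun c =>
    r_tendsto.const_div_atTop c
  have hg : Tendsto (fun k : ℕ => (k:ℝ) * (-(3 / 4) * (y / √((k:ℝ) + 1)) ^ 2 + (y / √((k:ℝ) + 1)) ^ 3 / 4))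
      atTop (𝓝 (-(3 / 4) * y ^ 2)) := by
    have h1 : Tendsto (fun k : ℕ => (k:ℝ) / (k + 1)) atTop (𝓝 1) := tendsto_natCast_div_add_atTop 1
    have h2 := h1.mul (((hw y).mul_const (y ^ 2 / 4)).const_add (-(3 / 4) * y ^ 2))
    rw [zero_mul, add_zero, one_mul] at h2
    refine h2.congr fun k => ?_
    have hr : 0 < √((k:ℝ) + 1) := by positivity
    have hr2 : (k:ℝ) + 1 = √((k:ℝ) + 1) ^ 2 := (sq_sqrt (by positivity)).symm
    generalize √((k:ℝ) + 1) = r at hr hr2 ⊢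
    rw [hr2]
    field_simp
  have hq := tendsto_one_add_pow_exp_of_tendsto hg
  have h3 := ((hw y).const_add 1).sqrt.mul hq.sqrt
  have e : √(1 + 0) * √(exp (-(3 / 4) * y ^ 2)) = exp (-(3 / 8) * y ^ 2) := by
    rw [← exp_half]; simp; ring
  rw [e] at h3
  refine h3.congr' ?_
  filter_upwards [(hw y).eventually (eventually_lt_nhds (show (0:ℝ) < 1 by norm_num)),
    (hw y).eventually (eventually_gt_nhds (show (-1:ℝ) < 0 by norm_num))] with k b1 b2
  unfold phiF
  set w := y / √((k:ℝ) + 1)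
  have hw1 : 0 ≤ 1 + w := by linarith
  have : 1 + (-(3 / 4) * w ^ 2 + w ^ 3 / 4) = (√(1 + w) * (1 - w / 2)) ^ 2 := by
    rw [mul_pow, sq_sqrt hw1]; ring
  rw [this, ← pow_mul, mul_comm 2 k, pow_mul, sqrt_sq, mul_pow, pow_succ]
  · ring
  · exact pow_nonneg (mul_nonneg (sqrt_nonneg _) (by linarith)) _

lemma dct (S : Set ℝ) :
    Tendsto (fun k : ℕ => ∫ y in S, (Set.Ioc (-√((k:ℝ) + 1)) (2 * √((k:ℝ) + 1))).indicator (phiF k) y)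
      atTop (𝓝 (∫ y in S, exp (-(3 / 8) * y ^ 2))) := by
  refine tendsto_integral_filter_of_dominated_convergence (fun y => 2 * exp (-(1 / 16) * y ^ 2)) ?_ ?_ ?_ ?_
  · refine Eventually.of_forall fun k => ?_
    refine (Measurable.indicator ?_ measurableSet_Ioc).aestronglyMeasurable
    have : Continuous (phiF k) := by unfold phiF; fun_prop
    exact this.measurable
  · filter_upwards [eventually_ge_atTop 1] with k hk
    refine Eventually.of_forall fun y => ?_
    by_cases hy : y ∈ Set.Ioc (-√((k:ℝ) + 1)) (2 * √((k:ℝ) + 1))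
    · rw [Set.indicator_of_mem hy]
      exact phiF_bound k hk y hy.1.le hy.2
    · rw [Set.indicator_of_notMem hy]
      simp [(exp_pos _).le]
  · exact ((integrable_exp_neg_mul_sq (by norm_num : (0:ℝ) < 1 / 16)).const_mul 2).integrableOn
  · refine Eventually.of_forall fun y => ?_
    refine (phiF_tendsto y).congr' ?_
    filter_upwards [r_tendsto.eventually_gt_atTop |y|] with k hk
    rw [Set.indicator_of_mem]
    have := abs_lt.mp hk
    have := abs_nonneg y
    constructor <;> linarith

lemma ratio_tendsto :
    Tendsto (fun k : ℕ => (∫ t in (0:ℝ)..(1/3), kerF k t) / ∫ t in (0:ℝ)..1, kerF k t) atTop (𝓝 (1 / 2)) := by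
  have h1 := dct (Set.Iic 0)
  have h2 := dct Set.univ
  have g2 : ∫ y in (Set.univ : Set ℝ), exp (-(3 / 8) * y ^ 2) = √(π / (3 / 8)) := by
    rw [setIntegral_univ, integral_gaussian]
  have g1 : ∫ y in Set.Iic (0:ℝ), exp (-(3 / 8) * y ^ 2) = √(π / (3 / 8)) / 2 := by
    rw [← integral_gaussian_Ioi]
    have := integral_comp_neg_Iic (0:ℝ) (fun y => exp (-(3 / 8) * y ^ 2))
    simpa using this
  rw [g1] at h1
  rw [g2] at h2
  have hpos : 0 < √(π / (3 / 8)) := by positivity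
  have h3 := h1.div h2 hpos.ne'
  have e : √(π / (3 / 8)) / 2 / √(π / (3 / 8)) = 1 / 2 := by field_simp
  rw [e] at h3
  refine h3.congr fun k => ?_
  have hr : 0 < √((k:ℝ) + 1) := by positivity
  have i1 := kerF_integral k 0 (by linarith)
  have i2 := kerF_integral k (2 * √(k + 1)) (by linarith)
  have e1 : (3 * √((k:ℝ) + 1))⁻¹ * 0 + 1 / 3 = 1 / 3 := by ring
  have e2 : (3 * √((k:ℝ) + 1))⁻¹ * (2 * √((k:ℝ) + 1)) + 1 / 3 = 1 := by field_simp; ring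
  rw [e1] at i1
  rw [e2] at i2
  have j1 : ∫ y in Set.Iic (0:ℝ), (Set.Ioc (-√((k:ℝ) + 1)) (2 * √((k:ℝ) + 1))).indicator (phiF k) y
      = ∫ y in (-√((k:ℝ) + 1))..0, phiF k y := by
    rw [setIntegral_indicator measurableSet_Ioc, intervalIntegral.integral_of_le (by linarith)]
    congr 2
    ext y
    simp only [Set.mem_inter_iff, Set.mem_Iic, Set.mem_Ioc]
    constructor
    · rintro ⟨a, b, c⟩; exact ⟨b, a⟩
    · rintro ⟨a, b⟩; exact ⟨b, a, by linarith⟩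
  have j2 : ∫ y in Set.univ, (Set.Ioc (-√((k:ℝ) + 1)) (2 * √((k:ℝ) + 1))).indicator (phiF k) y
      = ∫ y in (-√((k:ℝ) + 1))..(2 * √((k:ℝ) + 1)), phiF k y := by
    rw [setIntegral_univ, integral_indicator measurableSet_Ioc, intervalIntegral.integral_of_le (by linarith)]
  rw [i1, i2, mul_div_mul_left _ _ (by positivity)]
  exact congrArg₂ (· / ·) j1 j2

/-- Asymptotics of the genus-one coefficients:
`f⁽²⁾₂ⱼ u_c^{2j} j / (2j)! → 1/48` as `j → ∞`, where `u_c = 3^{1/4}/18`. -/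
theorem stmt14 :
    Filter.Tendsto
      (fun j : ℕ =>
        f2 j * ((3 : ℝ) ^ ((1 : ℝ) / 4) / 18) ^ (2 * j) * (j : ℝ) / Nat.factorial (2 * j))
      Filter.atTop (nhds (1 / 48)) := by
  rw [← Filter.tendsto_add_atTop_iff_nat 1]
  have h := ratio_tendsto.const_mul (1 / 24)
  rw [show (1 / 24 : ℝ) * (1 / 2) = 1 / 48 by norm_num] at h
  refine h.congr fun k => ?_
  unfold f2 cGenusOne
  rw [gosper, expr_eq_aux]
  generalize (∫ t in (0:ℝ)..(1/3), kerF k t) / (∫ t in (0:ℝ)..1, kerF k t) = R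
  have hu : ((3 : ℝ) ^ ((1 : ℝ) / 4) / 18) ^ (2 * (k + 1)) = 3 ^ ((k + 1 : ℝ) / 2) / 324 ^ (k + 1) := by
    rw [div_pow, pow_mul 18, ← rpow_natCast (3 ^ ((1:ℝ)/4)), ← rpow_mul (by norm_num)]
    congr 2
    · push_cast; ring
    · norm_num
  have h3 : (3:ℝ) ^ ((k + 1 : ℝ) / 2) * 3 ^ ((k + 1 : ℝ) / 2) = 3 ^ (k + 1) := by
    rw [← rpow_add (by norm_num), ← rpow_natCast]; congr 1; push_cast; ring
  rw [hu]
  have hf : ((2 * (k + 1)).factorial : ℝ) ≠ 0 := by positivity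
  have h324 : (324:ℝ) ^ (k + 1) = 3 * 108 * (3 ^ k * (72 ^ k * (3 / 2) ^ k)) := by
    rw [← mul_pow, ← mul_pow, pow_succ]; norm_num; ring
  have hk : ((k + 1 : ℕ) : ℝ) ≠ 0 := by positivity
  have hk2 : 3 * ((k + 1 : ℕ) : ℝ) + 2 ≠ 0 := by positivity
  rw [h324, Nat.add_sub_cancel]
  generalize (3:ℝ) ^ ((k + 1 : ℝ) / 2) = x at *
  generalize (((2 * (k + 1)).factorial : ℕ) : ℝ) = F at *
  generalize ((k + 1 : ℕ) : ℝ) = N at *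
  rw [pow_succ] at h3
  have p1 : (3:ℝ) ^ k ≠ 0 := by positivity
  have p2 : (72:ℝ) ^ k ≠ 0 := by positivity
  have p3 : (3 / 2:ℝ) ^ k ≠ 0 := by positivity
  generalize (3:ℝ) ^ k = a at *
  generalize (72:ℝ) ^ k = b at *
  generalize (3 / 2:ℝ) ^ k = c at *
  have : 162 * b * ((3 * N + 2) * (c * (3 * x) * R)) * F / (108 * N * (3 * N + 2)) * (x / (3 * 108 * (a * (b * c)))) * N / F
     = 486 / 108 / 324 * R * (x * x) / a := by
    field_simp
    ring
  rw [this, h3]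
  field_simp
  ring
end
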